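/- arXiv:2411.09281 — 3 statements merged into one kernel-verified Lean document; each statement's English description precedes it below -/
import Mathlib

section
/- Let K be a finite geometric simplicial complex in a real normed vector space and let U = {L_i}_{i∈I} be a family of subcomplexes covering K. If every intersection of elements of U is empty or collapsible (i.e., U is a strong-good cover), then every nonempty intersection of elements of U is contractible, i.e., the polyhedron of every nonempty intersection ⋂_{i∈J} L_i (J ⊆ I finite nonempty) is a contractible topological space; hence U is a good cover of K. -/
/-! ## Finite T₀-spaces as finite posets with the Alexandrov (down-set) topology -/

universe u v w

/-- The Alexandrov topology on a preorder: the open sets are the down-sets. -/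
def alexTop (P : Type u) [Preorder P] : TopologicalSpace P where
  IsOpen s := IsLowerSet s
  isOpen_univ := isLowerSet_univ
  isOpen_inter _ _ hs ht := hs.inter ht
  isOpen_sUnion _ hS := isLowerSet_sUnion hS

/-- A subset of a poset is contractible if, endowed with the Alexandrov topology of its
induced order, it is a contractible space. -/
def ContractibleSet {P : Type u} [Preorder P] (A : Set P) : Prop :=
  @ContractibleSpace A (alexTop A)

/-- A topological space is homotopically trivial if it is weak homotopy equivalent to a
point: nonempty, path-connected, and all homotopy groups `π_n`, `n ≥ 1`, are trivial at
every basepoint. -/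
def HTrivial (T : Type u) [TopologicalSpace T] : Prop :=
  Nonempty T ∧ PathConnectedSpace T ∧
    ∀ (n : ℕ) (x : T), Subsingleton (HomotopyGroup (Fin (n + 1)) T x)

/-- A subset of a poset is homotopically trivial if, with the Alexandrov topology of its
induced order, it is homotopically trivial as a space. -/
def HTrivialSet {P : Type u} [Preorder P] (A : Set P) : Prop :=
  @HTrivial A (alexTop A)

/-- `Û_x` relative to the subspace `A`: the points of `A` strictly below `x`. -/
def hatDown {P : Type u} [Preorder P] (A : Set P) (x : P) : Set P := {y ∈ A | y < x}

/-- `F̂_x` relative to the subspace `A`: the points of `A` strictly above `x`. -/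
def hatUp {P : Type u} [Preorder P] (A : Set P) (x : P) : Set P := {y ∈ A | x < y}

/-- One elementary collapse of finite spaces: remove from the subspace `A` a weak point,
i.e. a point `x ∈ A` such that `Û_x` or `F̂_x` (computed in `A`) is contractible. -/
def CollapseStep {P : Type u} [Preorder P] (A B : Set P) : Prop :=
  ∃ x ∈ A, (ContractibleSet (hatDown A x) ∨ ContractibleSet (hatUp A x)) ∧ B = A \ {x}

/-- The subspace `A` collapses to the subspace `B` (`A ↘ B`): `B` is obtained from `A` by
successively removing weak points. -/
def CollapsesToSet {P : Type u} [Preorder P] (A B : Set P) : Prop :=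
  Relation.ReflTransGen CollapseStep A B

/-- A subspace of a finite space is collapsible if it collapses to a single point. -/
def CollapsibleSet {P : Type u} [Preorder P] (A : Set P) : Prop :=
  ∃ x : P, CollapsesToSet A ({x} : Set P)

/-- A bundled finite poset, i.e. a finite T₀-space. -/
structure FinPoset : Type (u + 1) where
  carrier : Type u
  [po : PartialOrder carrier]
  [fin : Finite carrier]

attribute [instance] FinPoset.po FinPoset.fin

/-- The finite space `P` collapses to (a subspace order-isomorphic to) the finite
space `Q`. -/
def FinPoset.CollapsesTo (P Q : FinPoset.{u}) : Prop :=
  ∃ A : Set P.carrier, CollapsesToSet (Set.univ : Set P.carrier) A ∧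
    Nonempty (Q.carrier ≃o A)

/-- Two finite T₀-spaces have the same simple homotopy type (`X ⧸↘ Y`) if they are related
by the equivalence relation generated by collapses. -/
def SHE (P Q : FinPoset.{u}) : Prop := Relation.EqvGen FinPoset.CollapsesTo P Q

/-! ## Relations, hulls, relation cylinders -/

/-- The open hull of a subset: `{x : x ≤ a for some a ∈ A}`. -/
def openHull {P : Type u} [Preorder P] (A : Set P) : Set P := {x | ∃ a ∈ A, x ≤ a}

/-- The closure of a subset of a finite space: `{x : x ≥ a for some a ∈ A}`. -/
def cloHull {P : Type u} [Preorder P] (A : Set P) : Set P := {x | ∃ a ∈ A, a ≤ x}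

/-- `R⁻¹(B) = {x : x R y for some y ∈ B}`. -/
def relPre {X : Type u} {Y : Type v} (R : Set (X × Y)) (B : Set Y) : Set X :=
  {x | ∃ y ∈ B, (x, y) ∈ R}

/-- `R(A) = {y : x R y for some x ∈ A}`. -/
def relIm {X : Type u} {Y : Type v} (R : Set (X × Y)) (A : Set X) : Set Y :=
  {y | ∃ x ∈ A, (x, y) ∈ R}

/-- The composite `R₂ ∘ R₁ = {(x,z) : ∃ y, x R₁ y and y R₂ z}`. -/
def relComp {X : Type u} {Y : Type v} {Z : Type w} (R₁ : Set (X × Y)) (R₂ : Set (Y × Z)) :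
    Set (X × Z) :=
  {p | ∃ y : Y, (p.1, y) ∈ R₁ ∧ (y, p.2) ∈ R₂}

/-- The relation cylinder `B(R)` of a relation `R ⊆ X × Z`: the underlying set is the
disjoint union `X ⊔ Z`. -/
def RelCyl (X : Type u) (Z : Type u) [PartialOrder X] [PartialOrder Z]
    (R : Set (X × Z)) : Type u := X ⊕ Z

/-- The order of the relation cylinder: keep the given orders on `X` and `Z`, and set
`x ≤ z` for `x ∈ X`, `z ∈ Z` iff there are `x' ∈ X`, `z' ∈ Z` with `x ≤ x'`, `z' ≤ z` and
`x' R z'`. -/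
def RelCyl.le {X Z : Type u} [PartialOrder X] [PartialOrder Z] (R : Set (X × Z)) :
    X ⊕ Z → X ⊕ Z → Prop
  | .inl x, .inl x' => x ≤ x'
  | .inr z, .inr z' => z ≤ z'
  | .inl x, .inr z => ∃ (x' : X) (z' : Z), x ≤ x' ∧ z' ≤ z ∧ (x', z') ∈ R
  | .inr _, .inl _ => False

instance RelCyl.instPartialOrder {X Z : Type u} [PartialOrder X] [PartialOrder Z]
    (R : Set (X × Z)) : PartialOrder (RelCyl X Z R) where
  le := RelCyl.le R
  le_refl a := by cases a <;> exact _root_.le_refl _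
  le_trans a b c hab hbc := by
    cases a with
    | inl x =>
      cases b with
      | inl x' =>
        cases c with
        | inl x'' => exact _root_.le_trans (α := X) hab hbc
        | inr z =>
          obtain ⟨x1, z1, h1, h2, h3⟩ := hbc
          exact ⟨x1, z1, _root_.le_trans (α := X) hab h1, h2, h3⟩
      | inr z =>
        cases c with
        | inl x'' => exact (hbc : False).elim
        | inr z' =>
          obtain ⟨x1, z1, h1, h2, h3⟩ := hab
          exact ⟨x1, z1, h1, _root_.le_trans (α := Z) h2 hbc, h3⟩
    | inr z =>
      cases b with
      | inl x => exact (hab : False).elim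
      | inr z' =>
        cases c with
        | inl x => exact (hbc : False).elim
        | inr z'' => exact _root_.le_trans (α := Z) hab hbc
  le_antisymm a b hab hba := by
    cases a with
    | inl x =>
      cases b with
      | inl x' => exact congrArg Sum.inl (_root_.le_antisymm (α := X) hab hba)
      | inr z => exact (hba : False).elim
    | inr z =>
      cases b with
      | inl x => exact (hab : False).elim
      | inr z' => exact congrArg Sum.inr (_root_.le_antisymm (α := Z) hab hba)

instance RelCyl.instFinite {X Z : Type u} [PartialOrder X] [PartialOrder Z]
    [Finite X] [Finite Z] (R : Set (X × Z)) : Finite (RelCyl X Z R) :=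
  inferInstanceAs (Finite (X ⊕ Z))

/-! ## Finite abstract simplicial complexes and collapses -/

/-- A set of finite nonempty sets is an abstract simplicial complex if it is closed under
passing to nonempty subsets. -/
def IsComplex {V : Type u} (K : Set (Finset V)) : Prop :=
  ∀ s ∈ K, s.Nonempty ∧ ∀ t : Finset V, t ⊆ s → t.Nonempty → t ∈ K

/-- `s` is a free face of `K` with unique proper coface `t`. -/
def FreeFace {V : Type u} (K : Set (Finset V)) (s t : Finset V) : Prop :=
  s ∈ K ∧ t ∈ K ∧ s ⊂ t ∧ ∀ u ∈ K, s ⊂ u → u = t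

/-- An elementary collapse of simplicial complexes: remove a free face together with the
unique simplex properly containing it. -/
def CxStep {V : Type u} (K L : Set (Finset V)) : Prop :=
  ∃ s t : Finset V, FreeFace K s t ∧ L = K \ {s, t}

/-- `K` collapses to the subcomplex `L`. -/
def CxCollapsesTo {V : Type u} (K L : Set (Finset V)) : Prop :=
  Relation.ReflTransGen CxStep K L

/-- A simplicial complex is collapsible if it collapses to a single vertex. -/
def CxCollapsible {V : Type u} (K : Set (Finset V)) : Prop :=
  ∃ v : V, CxCollapsesTo K {({v} : Finset V)}

/-- A bundled simplicial complex: a vertex type together with a set of faces. -/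
structure SCx : Type (u + 1) where
  V : Type u
  faces : Set (Finset V)

/-- Generators of simple homotopy equivalence of complexes: elementary collapses and
simplicial isomorphisms. -/
inductive SCxRel : SCx.{u} → SCx.{u} → Prop
  | collapse (V : Type u) (K L : Set (Finset V)) : CxStep K L → SCxRel ⟨V, K⟩ ⟨V, L⟩
  | iso (K L : SCx.{u}) (e : K.V ≃ L.V) :
      (∀ s : Finset K.V, s ∈ K.faces ↔ s.map e.toEmbedding ∈ L.faces) → SCxRel K L

/-- Two simplicial complexes are simple homotopy equivalent if they are related by the
equivalence relation generated by elementary collapses (and isomorphism). -/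
def SCxSHE : SCx.{u} → SCx.{u} → Prop := Relation.EqvGen SCxRel

/-- The order complex `K(X)` of a poset: faces are the nonempty finite chains. -/
def orderComplex (X : Type u) [Preorder X] : Set (Finset X) :=
  {s | s.Nonempty ∧ IsChain (· ≤ ·) (↑s : Set X)}

/-- The nerve of a family of complexes (or of sets): faces are the nonempty finite
subsets of the index set whose members have nonempty intersection. -/
def nerveCx {I : Type u} {α : Type v} (L : I → Set α) : Set (Finset I) :=
  {J | J.Nonempty ∧ (⋂ i ∈ J, L i).Nonempty}

instance Finset.instFiniteOfFinite {I : Type u} [Finite I] : Finite (Finset I) :=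
  Finite.of_injective (fun s : Finset I => (s : Set I)) Finset.coe_injective

/-! ## Elementary collapses are deformation retractions -/

/-- A push along a fixed direction `c` that carries `B` into `A` and fixes `A` preserves
contractibility. -/
theorem contractibleSpace_of_push {E : Type*} [NormedAddCommGroup E] [NormedSpace ℝ E]
    {A B : Set E} (hAB : A ⊆ B) (μ : E → ℝ) (c : E) (hμ : ContinuousOn μ B)
    (hB : ∀ x ∈ B, ∀ θ ∈ Set.Icc (0 : ℝ) 1, x + (θ * μ x) • c ∈ B)
    (hA : ∀ x ∈ B, x + μ x • c ∈ A) (hfix : ∀ x ∈ A, μ x = 0) [ContractibleSpace A] :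
    ContractibleSpace B := by
  have hc : Continuous fun x : B => μ x := continuousOn_iff_continuous_domRestrict.mp hμ
  let r : C(B, A) := ⟨fun x => ⟨x + μ x • c, hA x x.2⟩,
    (continuous_subtype_val.add (hc.smul continuous_const)).subtype_mk _⟩
  let i : C(A, B) := ⟨Set.inclusion hAB, continuous_inclusion hAB⟩
  let H : (ContinuousMap.id B).Homotopy (i.comp r) :=
    { toFun := fun q => ⟨q.2 + ((q.1 : ℝ) * μ q.2) • c, hB q.2 q.2.2 q.1 q.1.2⟩
      continuous_toFun := ((continuous_subtype_val.comp continuous_snd).add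
        (((continuous_subtype_val.comp continuous_fst).mul (hc.comp continuous_snd)).smul
          continuous_const)).subtype_mk _
      map_zero_left := fun x => by ext; simp
      map_one_left := fun x => by ext; simp [i, r] }
  have hri : r.comp i = ContinuousMap.id A := by
    ext x
    simp [r, i, hfix x x.2]
  let e : ContinuousMap.HomotopyEquiv B A :=
    { toFun := r
      invFun := i
      left_inv := ⟨H.symm⟩
      right_inv := hri ▸ ContinuousMap.Homotopic.refl _ }
  exact e.contractibleSpace_iff.mpr ‹_›

/-- The barycentric coordinates of an affinely independent finite set extend to continuous
functionals on the ambient space. -/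
theorem exists_dual_coord {E : Type*} [NormedAddCommGroup E] [NormedSpace ℝ E] [DecidableEq E]
    {t : Finset E} (ht : AffineIndependent ℝ ((↑) : t → E)) {p v : E} (hp : p ∈ t) (hv : v ∈ t)
    (hvp : v ≠ p) :
    ∃ φ : E →L[ℝ] ℝ, ∀ y ∈ t, φ (y - p) = if y = v then 1 else 0 := by
  rw [affineIndependent_iff_linearIndependent_vsub ℝ _ (⟨p, hp⟩ : t)] at ht
  have hinj : Function.Injective (Finsupp.linearCombination ℝ
      fun i : {x : t // x ≠ ⟨p, hp⟩} => ((i : t) : E) -ᵥ p) := ht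
  obtain ⟨φ, hφ⟩ := SeparatingDual.dualMap_surjective_iff.mpr hinj
    (Finsupp.lapply ⟨⟨v, hv⟩, fun h => hvp (congrArg Subtype.val h)⟩)
  refine ⟨φ, fun y hy => ?_⟩
  by_cases hyp : y = p
  · subst hyp
    simp [hvp.symm]
  · have := LinearMap.congr_fun hφ
      (Finsupp.single ⟨⟨y, hy⟩, fun h => hyp (congrArg Subtype.val h)⟩ 1)
    simpa [Finsupp.single_apply] using this

theorem sum_insert_push {E F : Type*} [DecidableEq E] [AddCommGroup F] [Module ℝ F]
    {s : Finset E} {p : E} (hp : p ∉ s) (w : E → ℝ) (g : E → F) (a : ℝ) :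
    ∑ y ∈ insert p s, (if y = p then w p + s.card * a else w y - a) • g y
      = ∑ y ∈ insert p s, w y • g y + a • ∑ v ∈ s, (g p - g v) := by
  rw [Finset.sum_insert hp, Finset.sum_insert hp, if_pos rfl,
    Finset.sum_congr rfl fun v hv => by
      rw [if_neg fun h : v = p => hp (h ▸ hv), sub_smul]]
  simp only [Finset.sum_sub_distrib, Finset.sum_const, ← Finset.smul_sum, smul_sub, add_smul,
    mul_smul, Nat.cast_smul_eq_nsmul]
  rw [smul_comm a s.card (g p)]
  abel

/-- The simplex `insert p s` is pushed away from its face `s`, towards `p`, onto the union of the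
remaining facets. -/
theorem exists_simplex_push {E : Type*} [NormedAddCommGroup E] [NormedSpace ℝ E] [DecidableEq E]
    {s : Finset E} {p : E} (hs : s.Nonempty) (hp : p ∉ s)
    (hind : AffineIndependent ℝ ((↑) : {x // x ∈ insert p s} → E)) :
    ∃ (m : E → ℝ) (c : E), Continuous m ∧
      ∀ x ∈ convexHull ℝ ((insert p s : Finset E) : Set E),
        (∀ θ ∈ Set.Icc (0 : ℝ) 1,
          x + (θ * m x) • c ∈ convexHull ℝ ((insert p s : Finset E) : Set E)) ∧
        (∃ v ∈ s, x + m x • c ∈ convexHull ℝ (((insert p s).erase v : Finset E) : Set E)) ∧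
        ∀ u ⊆ insert p s, ¬ s ⊆ u → x ∈ convexHull ℝ (u : Set E) → m x = 0 := by
  have hne : ∀ v ∈ s, v ≠ p := fun v hv h => hp (h ▸ hv)
  have hcoord : ∀ v : E, ∃ φ : E →L[ℝ] ℝ, v ∈ s →
      ∀ y ∈ insert p s, φ (y - p) = if y = v then 1 else 0 := fun v => by
    by_cases hv : v ∈ s
    · obtain ⟨φ, hφ⟩ := exists_dual_coord hind (Finset.mem_insert_self p s)
        (Finset.mem_insert_of_mem hv) (hne v hv)
      exact ⟨φ, fun _ => hφ⟩
    · exact ⟨0, fun h => absurd h hv⟩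
  choose φ hφ using hcoord
  have heval : ∀ u ⊆ insert p s, ∀ w : E → ℝ, ∑ y ∈ u, w y = 1 → ∀ v ∈ s,
      φ v (∑ y ∈ u, w y • y - p) = if v ∈ u then w v else 0 := fun u hu w hw v hv => by
    have : ∑ y ∈ u, w y • y - p = ∑ y ∈ u, w y • (y - p) := by
      simp [smul_sub, Finset.sum_sub_distrib, ← Finset.sum_smul, hw]
    rw [this, map_sum, Finset.sum_congr rfl fun y hy => by
      rw [map_smul, hφ v hv y (hu hy), smul_eq_mul, mul_ite, mul_one, mul_zero]]
    simp
  refine ⟨fun x => s.inf' hs fun v => φ v (x - p), ∑ v ∈ s, (p - v), ?_, fun x hx => ?_⟩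
  · exact Continuous.finset_inf'_apply hs fun v _ => by fun_prop
  obtain ⟨w, hw0, hw1, rfl⟩ := Finset.mem_convexHull'.mp hx
  set x := ∑ y ∈ insert p s, w y • y
  have hφw : ∀ v ∈ s, φ v (x - p) = w v := fun v hv => by
    rw [heval _ subset_rfl w hw1 v hv, if_pos (Finset.mem_insert_of_mem hv)]
  have hm0 : 0 ≤ s.inf' hs fun v => φ v (x - p) :=
    Finset.le_inf' _ _ fun v hv => hφw v hv ▸ hw0 v (Finset.mem_insert_of_mem hv)
  have hmle : ∀ v ∈ s, (s.inf' hs fun v => φ v (x - p)) ≤ w v := fun v hv =>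
    hφw v hv ▸ Finset.inf'_le (fun v => φ v (x - p)) hv
  obtain ⟨v₀, hv₀, hmv₀⟩ := s.exists_mem_eq_inf' hs fun v => φ v (x - p)
  rw [hφw v₀ hv₀] at hmv₀
  dsimp only
  set m := s.inf' hs fun v => φ v (x - p)
  set w' : ℝ → E → ℝ := fun a y => if y = p then w p + s.card * a else w y - a
  have hw'1 : ∀ a, ∑ y ∈ insert p s, w' a y = 1 := fun a => by
    simpa [hw1] using sum_insert_push hp w (fun _ => (1 : ℝ)) a
  have hw'x : ∀ a, ∑ y ∈ insert p s, w' a y • y = x + a • ∑ v ∈ s, (p - v) := sum_insert_push hp w id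
  have hw'0 : ∀ a, 0 ≤ a → a ≤ m → ∀ y ∈ insert p s, 0 ≤ w' a y := fun a ha ham y hy => by
    rcases Finset.mem_insert.mp hy with rfl | hy
    · have := hw0 y (Finset.mem_insert_self y s)
      simp only [w', if_true]
      positivity
    · simp only [w', if_neg (hne y hy)]
      linarith [hmle y hy]
  refine ⟨fun θ hθ => ?_, ⟨v₀, hv₀, ?_⟩, fun u hu hsu hxu => ?_⟩
  · exact Finset.mem_convexHull'.mpr ⟨w' (θ * m), hw'0 _ (mul_nonneg hθ.1 hm0)
      (mul_le_of_le_one_left hm0 hθ.2), hw'1 _, hw'x _⟩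
  · have hz : w' m v₀ = 0 := by simp [w', hne v₀ hv₀, hmv₀]
    refine Finset.mem_convexHull'.mpr ⟨w' m, fun y hy => hw'0 m hm0 le_rfl y
      (Finset.mem_of_mem_erase hy), ?_, ?_⟩
    · rw [Finset.sum_erase _ hz, hw'1]
    · rw [Finset.sum_erase _ (by rw [hz, zero_smul]), hw'x]
  · obtain ⟨v, hv, hvu⟩ := Finset.not_subset.mp hsu
    obtain ⟨w₁, -, hw₁, hwx⟩ := Finset.mem_convexHull'.mp hxu
    have := heval u hu w₁ hw₁ v hv
    rw [hwx, if_neg hvu, hφw v hv] at this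
    exact le_antisymm (this ▸ hmle v hv) hm0

theorem FreeFace.exists_eq_insert {V : Type*} [DecidableEq V] {F : Set (Finset V)}
    {s t : Finset V} (hF : IsComplex F) (h : FreeFace F s t) : ∃ p ∉ s, t = insert p s := by
  obtain ⟨-, ht, hst, huniq⟩ := h
  obtain ⟨p, hpt, hps⟩ := Finset.exists_of_ssubset hst
  exact ⟨p, hps, (huniq _ ((hF t ht).2 _ (Finset.insert_subset hpt hst.subset)
    (Finset.insert_nonempty p s)) (Finset.ssubset_insert hps)).symm⟩

theorem FreeFace.isComplex_sdiff {V : Type*} {F : Set (Finset V)} {s t : Finset V}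
    (hF : IsComplex F) (h : FreeFace F s t) : IsComplex (F \ {s, t}) := by
  obtain ⟨-, -, hst, huniq⟩ := h
  rintro u ⟨huF, hu⟩
  simp only [Set.mem_insert_iff, Set.mem_singleton_iff, not_or] at hu
  refine ⟨(hF u huF).1, fun w hwu hw => ⟨(hF u huF).2 w hwu hw, ?_⟩⟩
  rintro (rfl | rfl)
  · exact hu.2 (huniq u huF (hwu.ssubset_of_ne (Ne.symm hu.1)))
  · exact hu.2 (huniq u huF (hst.trans_subset hwu))

theorem contractibleSpace_of_freeFace {E : Type*} [NormedAddCommGroup E] [NormedSpace ℝ E]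
    (K : Geometry.SimplicialComplex ℝ E) {F : Set (Finset E)} (hFK : F ⊆ K.faces)
    (hfin : F.Finite) (hF : IsComplex F) {s t : Finset E} (h : FreeFace F s t)
    (hcon : ContractibleSpace
      (⋃ u ∈ F \ {s, t}, (convexHull ℝ (u : Set E)) : Set E)) :
    ContractibleSpace (⋃ u ∈ F, (convexHull ℝ (u : Set E)) : Set E) := by
  classical
  obtain ⟨p, hp, rfl⟩ := h.exists_eq_insert hF
  obtain ⟨hsF, htF, hst, huniq⟩ := h
  set t := insert p s
  obtain ⟨m, c, hm, hpush⟩ := exists_simplex_push (hF s hsF).1 hp (K.indep (hFK htF))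
  set A : Set E := ⋃ u ∈ F \ {s, t}, convexHull ℝ (u : Set E)
  set B : Set E := ⋃ u ∈ F, convexHull ℝ (u : Set E)
  set T : Set E := convexHull ℝ (t : Set E)
  have hAB : A ⊆ B := Set.biUnion_subset_biUnion_left Set.sdiff_subset
  have hTB : T ⊆ B :=
    Set.subset_biUnion_of_mem (u := fun u : Finset E => convexHull ℝ (u : Set E)) htF
  have hBAT : B = A ∪ T := by
    refine subset_antisymm (Set.iUnion₂_subset fun u hu x hx => ?_) (Set.union_subset hAB hTB)
    by_cases hut : u ⊆ t
    · exact Or.inr (convexHull_mono (Finset.coe_subset.mpr hut) hx)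
    · refine Or.inl (Set.mem_biUnion ⟨hu, ?_⟩ hx)
      rintro (rfl | rfl)
      exacts [hut hst.subset, hut subset_rfl]
  have hzero : ∀ x ∈ A, x ∈ T → m x = 0 := fun x hxA hxT => by
    obtain ⟨u, ⟨huF, hu⟩, hxu⟩ := Set.mem_iUnion₂.mp hxA
    simp only [Set.mem_insert_iff, Set.mem_singleton_iff, not_or] at hu
    refine (hpush x hxT).2.2 (u ∩ t) Finset.inter_subset_right (fun hsu => ?_) ?_
    · exact hu.2 (huniq u huF
        ((hsu.trans Finset.inter_subset_left).ssubset_of_ne (Ne.symm hu.1)))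
    · rw [Finset.coe_inter]
      exact K.inter_subset_convexHull (hFK huF) (hFK htF) ⟨hxu, hxT⟩
  have hclosed : ∀ u : Finset E, IsClosed (convexHull ℝ (u : Set E)) := fun u =>
    (u.finite_toSet.isCompact_convexHull ℝ).isClosed
  have hA_closed : IsClosed A :=
    (hfin.subset Set.sdiff_subset).isClosed_biUnion fun u _ => hclosed u
  refine contractibleSpace_of_push hAB (T.indicator m) c ?_ (fun x hx θ hθ => ?_)
    (fun x hx => ?_) (fun x hx => ?_)
  · rw [hBAT]
    refine ContinuousOn.union_of_isClosed ?_ ?_ hA_closed (hclosed t)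
    · refine (continuousOn_const (c := (0 : ℝ))).congr fun x hx => ?_
      by_cases hxT : x ∈ T <;> simp [hxT, hzero x hx]
    · exact hm.continuousOn.congr fun x hx => Set.indicator_of_mem hx m
  · by_cases hxT : x ∈ T
    · rw [Set.indicator_of_mem hxT]
      exact hTB ((hpush x hxT).1 θ hθ)
    · simpa [hxT] using hx
  · by_cases hxT : x ∈ T
    · rw [Set.indicator_of_mem hxT]
      obtain ⟨v, hv, hxv⟩ := (hpush x hxT).2.1
      have hpv : p ∈ t.erase v := Finset.mem_erase.mpr
        ⟨fun h => hp (h ▸ hv), Finset.mem_insert_self p s⟩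
      refine Set.mem_biUnion ⟨(hF t htF).2 _ (Finset.erase_subset v t) ⟨p, hpv⟩, ?_⟩ hxv
      rintro (h | h)
      · exact hp (h ▸ hpv)
      · exact Finset.erase_eq_self.mp h (hst.subset hv)
    · rw [hBAT] at hx
      simpa [hxT] using hx.resolve_right hxT
  · by_cases hxT : x ∈ T <;> simp [hxT, hzero x hx]

theorem CxCollapsible.contractibleSpace {E : Type*} [NormedAddCommGroup E] [NormedSpace ℝ E]
    (K : Geometry.SimplicialComplex ℝ E) {F : Set (Finset E)} (hFK : F ⊆ K.faces)
    (hfin : F.Finite) (hF : IsComplex F) (h : CxCollapsible F) :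
    ContractibleSpace (⋃ u ∈ F, (convexHull ℝ (u : Set E)) : Set E) := by
  obtain ⟨v, hv⟩ := h
  induction hv using Relation.ReflTransGen.head_induction_on with
  | refl =>
    rw [Set.biUnion_singleton, Finset.coe_singleton, convexHull_singleton]
    infer_instance
  | head hstep _ ih =>
    obtain ⟨s, t, hst, rfl⟩ := hstep
    exact contractibleSpace_of_freeFace K hFK hfin hF hst
      (ih (Set.sdiff_subset.trans hFK) (hfin.subset Set.sdiff_subset) (hst.isComplex_sdiff hF))

open Geometry in
/-- A strong-good cover of a finite geometric simplicial complex is a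
good cover: every nonempty intersection of the cover has contractible polyhedron. -/
theorem stmt_5 {E : Type u} [NormedAddCommGroup E] [NormedSpace ℝ E]
    (K : SimplicialComplex ℝ E) (hKfin : K.faces.Finite)
    {I : Type v} (L : I → SimplicialComplex ℝ E)
    (hsub : ∀ i, (L i).faces ⊆ K.faces)
    (hcover : (⋃ i, (L i).faces) = K.faces)
    (hstrong : ∀ J : Set I, J.Nonempty →
      (⋂ i ∈ J, (L i).faces) = ∅ ∨ CxCollapsible (⋂ i ∈ J, (L i).faces)) :
    ∀ J : Set I, J.Nonempty → (⋂ i ∈ J, (L i).faces).Nonempty →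
      ContractibleSpace (⋃ s ∈ (⋂ i ∈ J, (L i).faces), (convexHull ℝ (s : Set E)) : Set E) := by
  intro J hJ hne
  have hJK : (⋂ i ∈ J, (L i).faces) ⊆ K.faces := by
    obtain ⟨i, hi⟩ := hJ
    exact (Set.biInter_subset_of_mem hi).trans (hsub i)
  refine ((hstrong J hJ).resolve_left hne.ne_empty).contractibleSpace K hJK (hKfin.subset hJK)
    fun s hs => ⟨K.nonempty_of_mem_faces (hJK hs), fun t hts ht => ?_⟩
  exact Set.mem_iInter₂.mpr fun i hi => (L i).down_closed (Set.mem_iInter₂.mp hs i hi) hts ht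
end

section
/- Let X be a finite T0-space and let U = {U_i}_{i∈I} be a family of open subspaces covering X. If every intersection of elements of U is empty or collapsible (i.e., U is a strong-good cover of X), then every nonempty intersection of elements of U is homotopically trivial; hence U is a good cover of X. -/
/-! ## Finite T₀-spaces as finite posets with the Alexandrov (down-set) topology -/

universe u v w

section

open scoped unitInterval Topology

/-- A space is `MetrizablyTrivial` if every continuous map into it from a metrizable space is
null-homotopic. -/
def MetrizablyTrivial (T : Type u) [TopologicalSpace T] : Prop :=
  ∀ (K : Type) [TopologicalSpace K] [TopologicalSpace.MetrizableSpace K] (f : C(K, T)),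
    f.Nullhomotopic

namespace MetrizablyTrivial

variable {T : Type u} {S : Type v} [TopologicalSpace T] [TopologicalSpace S]

theorem of_comp_homotopic_id (hT : MetrizablyTrivial T) (i : C(S, T)) (r : C(T, S))
    (h : (r.comp i).Homotopic (ContinuousMap.id S)) : MetrizablyTrivial S := by
  intro K _ _ f
  obtain ⟨y, hy⟩ := (hT K (i.comp f)).comp_right r
  refine ⟨y, ?_⟩
  have h1 : ((r.comp i).comp f).Homotopic ((ContinuousMap.id S).comp f) :=
    h.comp (ContinuousMap.Homotopic.refl f)
  exact h1.symm.trans hy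

theorem congr (e : S ≃ₜ T) : MetrizablyTrivial S ↔ MetrizablyTrivial T := by
  constructor
  · intro h
    refine h.of_comp_homotopic_id ⟨e.symm, e.symm.continuous⟩ ⟨e, e.continuous⟩ ?_
    convert ContinuousMap.Homotopic.refl _
    ext x
    simp
  · intro h
    refine h.of_comp_homotopic_id ⟨e, e.continuous⟩ ⟨e.symm, e.symm.continuous⟩ ?_
    convert ContinuousMap.Homotopic.refl _
    ext x
    simp

theorem of_subsingleton [Nonempty S] [Subsingleton S] : MetrizablyTrivial S := by
  intro K _ _ f
  obtain ⟨s⟩ := ‹Nonempty S›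
  refine ⟨s, ?_⟩
  convert ContinuousMap.Homotopic.refl _
  ext x
  exact Subsingleton.elim _ _

theorem nonempty (hT : MetrizablyTrivial T) : Nonempty T := by
  obtain ⟨y, -⟩ := hT Empty ⟨fun e => e.elim, continuous_of_discreteTopology⟩
  exact ⟨y⟩

theorem pathConnectedSpace (hT : MetrizablyTrivial T) : PathConnectedSpace T := by
  refine ⟨hT.nonempty, fun a b => ?_⟩
  obtain ⟨y, ⟨H⟩⟩ := hT Bool ⟨fun t => cond t a b, continuous_of_discreteTopology⟩
  have key : ∀ t : Bool, Joined (cond t a b) y := fun t =>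
    ⟨⟨⟨fun s => H (s, t), by fun_prop⟩, by simp, by simp⟩⟩
  exact (key true).trans (key false).symm

/-- Maps from the unit sphere extend to the whole space. -/
theorem exists_extension_sphere (hT : MetrizablyTrivial T) {E : Type} [NormedAddCommGroup E]
    [NormedSpace ℝ E] (F : C(Metric.sphere (0 : E) 1, T)) :
    ∃ G : C(E, T), ∀ p : Metric.sphere (0 : E) 1, G p = F p := by
  classical
  obtain ⟨c, ⟨H⟩⟩ := hT _ F
  let s : E → I := fun p => Set.projIcc 0 1 zero_le_one (2 - 2 * ‖p‖)
  have hs : Continuous s := continuous_projIcc.comp (by fun_prop)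
  let q : {p : E // p ≠ 0} → Metric.sphere (0 : E) 1 := fun p =>
    ⟨‖p.1‖⁻¹ • p.1, by
      have : ‖p.1‖ ≠ 0 := norm_ne_zero_iff.2 p.2
      simp [norm_smul, this]⟩
  have hq : Continuous q := by
    refine Continuous.subtype_mk ?_ _
    refine Continuous.smul (Continuous.inv₀ (by fun_prop) fun p => norm_ne_zero_iff.2 p.2)
      (by fun_prop)
  let G : E → T := fun p => if h : p = 0 then c else H (s p, q ⟨p, h⟩)
  have hG : Continuous G := by
    rw [continuous_iff_continuousAt]
    intro p
    by_cases hp : p = 0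
    · have hev : G =ᶠ[𝓝 p] fun _ => c := by
        have : ∀ᶠ p' in 𝓝 p, ‖p'‖ < 1 / 2 := by
          refine (continuous_norm.tendsto p).eventually (Iio_mem_nhds ?_)
          simp [hp]
        filter_upwards [this] with p' hp'
        by_cases h0 : p' = 0
        · simp [G, h0]
        · have : s p' = 1 := Set.projIcc_of_right_le _ (by linarith)
          simp [G, h0, this]
      exact continuousAt_const.congr hev.symm
    · have hopen : IsOpen {p : E | p ≠ 0} := isOpen_ne
      have : ContinuousOn G {p : E | p ≠ 0} := by
        rw [continuousOn_iff_continuous_domRestrict]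
        have : Set.domRestrict {p : E | p ≠ 0} G = fun p => H (s p.1, q p) := by
          funext p
          exact dif_neg p.2
        rw [this]
        exact H.continuous.comp ((hs.comp continuous_subtype_val).prodMk hq)
      exact this.continuousAt (hopen.mem_nhds hp)
  refine ⟨⟨G, hG⟩, fun p => ?_⟩
  have h1 : ‖p.1‖ = 1 := by simp
  have h0 : p.1 ≠ 0 := by
    rintro h
    simp [h] at h1
  have h2 : s p.1 = 0 := Set.projIcc_of_le_left _ (by linarith)
  have h3 : q ⟨p.1, h0⟩ = p := by
    ext
    simp [q, h1]
  simp [G, h0, h2, h3]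

theorem subsingleton_homotopyGroup (hT : MetrizablyTrivial T) (n : ℕ) (x : T) :
    Subsingleton (HomotopyGroup (Fin (n + 1)) T x) := by
  suffices h : ∀ f : GenLoop (Fin (n + 1)) T x,
      GenLoop.Homotopic f (GenLoop.const : GenLoop (Fin (n + 1)) T x) by
    refine ⟨fun a b => ?_⟩
    induction a using Quotient.inductionOn with | _ a => ?_
    induction b using Quotient.inductionOn with | _ b => ?_
    exact Quotient.sound ((h a).trans (h b).symm)
  intro f
  let cl : ℝ → I := fun t => Set.projIcc 0 1 zero_le_one ((t + 1) / 2)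
  have hcl : Continuous cl := continuous_projIcc.comp (by fun_prop)
  let g : (Fin (n + 1) → ℝ) → T := fun y => f.1 fun i => cl (y i)
  have hg : Continuous g := f.1.continuous.comp (by fun_prop)
  have hgx : ∀ y : Fin (n + 1) → ℝ, ‖y‖ = 1 → g y = x := by
    intro y hy
    obtain ⟨i, hi⟩ : ∃ i, 1 ≤ |y i| := by
      by_contra! hc
      have := (pi_norm_lt_iff (x := y) one_pos).2 hc
      linarith
    refine f.2 _ ⟨i, ?_⟩
    rcases le_abs.1 hi with h | h
    · exact Or.inr (Set.projIcc_of_right_le _ (by linarith))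
    · exact Or.inl (Set.projIcc_of_le_left _ (by linarith))
  let F : C(Metric.sphere (0 : (Fin (n + 1) → ℝ) × ℝ) 1, T) :=
    ⟨fun p => if p.1.2 ≤ 0 then g p.1.1 else x, by
      refine Continuous.if_le (by fun_prop) (by fun_prop) (by fun_prop) (by fun_prop) ?_
      intro p hp
      apply hgx
      have h1 : ‖p.1‖ = 1 := by simp
      rw [Prod.norm_def, hp] at h1
      simpa using h1⟩
  obtain ⟨G, hGF⟩ := hT.exists_extension_sphere F
  have hGF' : ∀ p : (Fin (n + 1) → ℝ) × ℝ, ‖p‖ = 1 → G p = if p.2 ≤ 0 then g p.1 else x :=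
    fun p hp => hGF ⟨p, by simpa using hp⟩
  let sc : (Fin (n + 1) → I) → (Fin (n + 1) → ℝ) := fun y i => 2 * (y i : ℝ) - 1
  have hsc : ∀ y, ‖sc y‖ ≤ 1 := by
    intro y
    rw [pi_norm_le_iff_of_nonneg zero_le_one]
    intro i
    have := (y i).2.1
    have := (y i).2.2
    rw [Real.norm_eq_abs, abs_le]
    constructor <;> simp only [sc] <;> linarith
  have hscb : ∀ y ∈ Cube.boundary (Fin (n + 1)), ‖sc y‖ = 1 := by
    rintro y ⟨i, hi⟩
    refine le_antisymm (hsc y) ?_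
    refine le_trans ?_ (norm_le_pi_norm (sc y) i)
    rcases hi with h | h <;> norm_num [sc, h]
  have hgsc : ∀ y, g (sc y) = f.1 y := by
    intro y
    simp only [g]
    congr 1
    funext i
    have : (sc y i + 1) / 2 = y i := by
      simp only [sc]
      ring
    simp only [cl, this]
    exact Set.projIcc_val _ _
  have hc : Continuous fun p : I × (Fin (n + 1) → I) => G (sc p.2, 2 * (p.1 : ℝ) - 1) := by
    refine G.continuous.comp ?_
    simp only [sc]
    fun_prop
  refine ⟨⟨⟨⟨fun p => G (sc p.2, 2 * (p.1 : ℝ) - 1), hc⟩, ?_, ?_⟩, ?_⟩⟩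
  · intro y
    have : ‖(sc y, (-1 : ℝ))‖ = 1 := by
      simpa [Prod.norm_def] using hsc y
    simp only [Set.Icc.coe_zero, mul_zero, zero_sub]
    rw [hGF' _ this, if_pos (by norm_num), hgsc]
  · intro y
    have : ‖(sc y, (1 : ℝ))‖ = 1 := by
      simpa [Prod.norm_def] using hsc y
    simp only [Set.Icc.coe_one, mul_one]
    norm_num
    rw [hGF' _ this, if_neg (by norm_num)]
  · intro t y hy
    have h1 := hscb y hy
    have h2 : ‖(sc y, 2 * (t : ℝ) - 1)‖ = 1 := by
      have := t.2.1
      have := t.2.2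
      have h3 : |2 * (t : ℝ) - 1| ≤ 1 := by
        rw [abs_le]
        constructor <;> linarith
      simpa [Prod.norm_def, h1] using h3
    change G (sc y, 2 * (t : ℝ) - 1) = f.1 y
    rw [hGF' _ h2, f.2 y hy, hgx _ h1, ite_self]

theorem hTrivial (hT : MetrizablyTrivial T) : HTrivial T :=
  ⟨hT.nonempty, hT.pathConnectedSpace, hT.subsingleton_homotopyGroup⟩

end MetrizablyTrivial

/-- The preorder `P` regarded as a space with the Alexandrov topology. -/
def Alex (P : Type u) : Type u := P

instance (P : Type u) [Preorder P] : TopologicalSpace (Alex P) := alexTop P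

namespace Alex

variable {P : Type u} {Q : Type v} [PartialOrder P] [PartialOrder Q]

theorem continuous_iff {K : Type*} [TopologicalSpace K] {f : K → P} :
    Continuous (Y := Alex P) f ↔ ∀ k, ∀ᶠ k' in 𝓝 k, f k' ≤ f k := by
  constructor
  · intro h k
    have : IsOpen (X := Alex P) (Set.Iic (f k) : Set P) := isLowerSet_Iic (f k)
    exact (this.preimage h).mem_nhds (le_refl (f k))
  · intro h
    refine ⟨fun s hs => isOpen_iff_mem_nhds.2 fun k hk => ?_⟩
    filter_upwards [h k] with k' hk'
    exact (show IsLowerSet (α := P) s from hs) hk' hk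

/-- A monotone map as a continuous map. -/
def map (f : P →o Q) : C(Alex P, Alex Q) :=
  ⟨(f : P → Q), ⟨fun s hs _ _ hab hb =>
    (show IsLowerSet (α := Q) s from hs) (f.monotone hab) hb⟩⟩

/-- An order isomorphism as a homeomorphism. -/
def homeomorph (e : P ≃o Q) : Alex P ≃ₜ Alex Q where
  toEquiv := show P ≃ Q from e.toEquiv
  continuous_toFun := (map (e : P →o Q)).continuous
  continuous_invFun := (map (e.symm : Q →o P)).continuous

/-- Pointwise comparable maps are homotopic. -/
theorem homotopic_of_le {K : Type*} [TopologicalSpace K] (f g : C(K, Alex P))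
    (h : ∀ k, LE.le (α := P) (f k) (g k)) : f.Homotopic g := by
  classical
  let F : I × K → P := fun p => if p.1 < 1 then f p.2 else g p.2
  have hf := (continuous_iff (P := P)).1 f.continuous
  have hg := (continuous_iff (P := P)).1 g.continuous
  have hF : Continuous (Y := Alex P) F := by
    rw [continuous_iff]
    rintro ⟨t, k⟩
    by_cases ht : t < 1
    · have h1 : ∀ᶠ p : I × K in 𝓝 (t, k), p.1 < 1 :=
        continuous_fst.continuousAt.eventually (Iio_mem_nhds ht)
      filter_upwards [h1, continuous_snd.continuousAt.eventually (hf k)] with p hp hp'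
      have e : F p = f p.2 := if_pos hp
      have e' : F (t, k) = f k := if_pos ht
      rw [e, e']
      exact hp'
    · filter_upwards [continuous_snd.continuousAt.eventually (hg k)] with p hp'
      have e' : F (t, k) = g k := if_neg ht
      rw [e']
      by_cases hp : p.1 < 1
      · have e : F p = f p.2 := if_pos hp
        rw [e]
        exact (h p.2).trans hp'
      · have e : F p = g p.2 := if_neg hp
        rw [e]
        exact hp'
  exact ⟨⟨⟨F, hF⟩, fun k => if_pos zero_lt_one, fun k => if_neg (lt_irrefl _)⟩⟩

theorem contractibleSpace_of_retract (i : P →o Q) (r : Q →o P) (hri : ∀ p, r (i p) = p)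
    (hir : ∀ q, q ≤ i (r q)) [ContractibleSpace (Alex P)] : ContractibleSpace (Alex Q) := by
  have e : ContinuousMap.HomotopyEquiv (Alex Q) (Alex P) :=
    { toFun := map r
      invFun := map i
      left_inv := (homotopic_of_le _ _ hir).symm
      right_inv := by
        convert ContinuousMap.Homotopic.refl _
        ext p
        exact (hri p).symm }
  exact e.contractibleSpace

theorem contractibleSpace_of_isLeast {a : P} (ha : ∀ p, a ≤ p) : ContractibleSpace (Alex P) := by
  rw [contractible_iff_id_nullhomotopic]
  exact ⟨a, (homotopic_of_le (ContinuousMap.const _ (show Alex P from a)) _ ha).symm⟩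

/-- The function used to deform a map away from a point `x`: it is `1` near the preimage of `x`
and `0` near the points with value incomparable to `x`. -/
theorem exists_cutoff (x : P) {K : Type*} [TopologicalSpace K] [TopologicalSpace.MetrizableSpace K]
    {g : K → P} (hg : ∀ k, ∀ᶠ k' in 𝓝 k, g k' ≤ g k) :
    ∃ φ : K → I, ContinuousOn φ {k | ¬ x < g k} ∧ (∀ k, g k = x → ∀ᶠ k' in 𝓝 k, φ k' = 1) ∧
      ∀ k, ¬ x ≤ g k → ¬ g k ≤ x → ∀ᶠ k' in 𝓝 k, φ k' = 0 := by
  classical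
  let M : Set K := {k | ¬ x < g k}
  have hM : IsOpen M := by
    refine isOpen_iff_mem_nhds.2 fun k hk => ?_
    filter_upwards [hg k] with k' hk' hx
    exact hk (hx.trans_le hk')
  have hg' : ∀ k : M, ∀ᶠ k' : M in 𝓝 k, g k' ≤ g k := fun k =>
    continuous_subtype_val.continuousAt.eventually (hg k)
  have hN : IsClosed {k : M | ¬ g k ≤ x} := by
    refine ⟨isOpen_iff_mem_nhds.2 fun k hk => ?_⟩
    filter_upwards [hg' k] with k' hk' hx
    exact hx (hk'.trans (not_not.1 hk))
  have hY : IsClosed {k : M | g k = x} := by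
    refine ⟨isOpen_iff_mem_nhds.2 fun k hk => ?_⟩
    filter_upwards [hg' k] with k' hk' hx
    have hx' : g k' = x := hx
    rw [hx'] at hk'
    exact k.2 (lt_of_le_of_ne hk' (Ne.symm hk))
  have hd : Disjoint {k : M | ¬ g k ≤ x} {k : M | g k = x} :=
    Set.disjoint_left.2 fun k h1 h2 => h1 (le_of_eq h2)
  let := TopologicalSpace.metrizableSpaceMetric K
  obtain ⟨φ, hφN, hφY, -⟩ := exists_continuous_zero_one_of_isClosed hN hY hd
  let ψ : K → ℝ := fun k => if h : k ∈ M then φ ⟨k, h⟩ else 0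
  have hψ : ContinuousOn ψ M := by
    rw [continuousOn_iff_continuous_domRestrict]
    have : M.domRestrict ψ = φ := by
      funext k
      exact dif_pos k.2
    rw [this]
    exact φ.continuous
  have hψat : ∀ k ∈ M, ContinuousAt ψ k := fun k hk => hψ.continuousAt (hM.mem_nhds hk)
  refine ⟨fun k => Set.projIcc 0 1 zero_le_one (3 * ψ k - 1), ?_, ?_, ?_⟩
  · exact continuous_projIcc.comp_continuousOn ((continuousOn_const.mul hψ).sub continuousOn_const)
  · intro k hk
    have hkM : k ∈ M := fun h => h.ne' hk
    have h1 : ψ k = 1 := by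
      simp only [ψ, hkM, dif_pos]
      exact hφY hk
    filter_upwards [(hψat k hkM).eventually (Ioi_mem_nhds (show 2 / 3 < ψ k by rw [h1]; norm_num))]
      with k' hk'
    exact Set.projIcc_of_right_le _ (by linarith [show 2 / 3 < ψ k' from hk'])
  · intro k hk hk2
    have hkM : k ∈ M := fun h => hk h.le
    have h1 : ψ k = 0 := by
      simp only [ψ, hkM, dif_pos]
      exact hφN hk2
    filter_upwards [(hψat k hkM).eventually (Iio_mem_nhds (show ψ k < 1 / 3 by rw [h1]; norm_num))]
      with k' hk'
    exact Set.projIcc_of_le_left _ (by linarith [show ψ k' < 1 / 3 from hk'])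

/-- If `Û_x` is contractible, maps from metrizable spaces can be deformed off `x`, without
ever moving a value different from `x` onto `x`. -/
theorem exists_homotopy_off (x : P) [ContractibleSpace (Alex {y : P // y < x})] {K : Type*}
    [TopologicalSpace K] [TopologicalSpace.MetrizableSpace K] (g : C(K, Alex P)) :
    ∃ G : C(I × K, Alex P), (∀ k, G (0, k) = g k) ∧ (∀ k, G (1, k) ≠ x) ∧
      ∀ p, G p = x → g p.2 = x := by
  classical
  obtain ⟨c, ⟨H⟩⟩ := id_nullhomotopic (Alex {y : P // y < x})
  let H' : I → {y : P // y < x} → {y : P // y < x} := fun t y => H (t, y)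
  have hH0 : ∀ y, H' 0 y = y := fun y => H.map_zero_left y
  have hH1 : ∀ y, H' 1 y = c := fun y => H.map_one_left y
  let γ : K → P := g
  have hγ : ∀ k, ∀ᶠ k' in 𝓝 k, γ k' ≤ γ k := (continuous_iff (P := P)).1 g.continuous
  obtain ⟨φ, hφ, hφY, hφN⟩ := exists_cutoff x hγ
  let τ : I → I := fun t => Set.projIcc 0 1 zero_le_one (2 * (t : ℝ))
  have hτ : Continuous τ := continuous_projIcc.comp (by fun_prop)
  have hτ0 : τ 0 = 0 := Set.projIcc_of_le_left _ (by simp)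
  have hτ1 : ∀ t : I, 1 / 2 < (t : ℝ) → τ t = 1 := fun t ht =>
    Set.projIcc_of_right_le _ (by linarith)
  let c' : P := (show {y : P // y < x} from c).1
  have hc' : c' < x := (show {y : P // y < x} from c).2
  let G : I × K → P := fun p =>
    if h : γ p.2 < x then (H' (τ p.1 * φ p.2) ⟨γ p.2, h⟩).1
    else if γ p.2 = x then (if (p.1 : ℝ) ≤ 1 / 2 then x else c') else γ p.2
  have hGle : ∀ p, γ p.2 ≤ x → G p ≤ x := by
    intro p hp
    simp only [G]
    split_ifs with h1 h2
    · exact (H' (τ p.1 * φ p.2) ⟨γ p.2, h1⟩).2.le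
    · exact le_rfl
    · exact hc'.le
    · exact hp
  have hsnd : ∀ (q : K → Prop) (t : I) (k : K), (∀ᶠ k' in 𝓝 k, q k') →
      ∀ᶠ p : I × K in 𝓝 (t, k), q p.2 := fun q t k h =>
    continuous_snd.continuousAt.eventually h
  have hG : Continuous (Y := Alex P) G := by
    rw [continuous_iff]
    rintro ⟨t, k⟩
    by_cases h1 : γ k < x
    · let W : Set (I × K) := {p | γ p.2 < x}
      have hW : IsOpen W := by
        refine isOpen_iff_mem_nhds.2 fun p hp => ?_
        filter_upwards [hsnd _ p.1 p.2 (hγ p.2)] with p' hp'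
        exact lt_of_le_of_lt hp' hp
      let w : W → {y : P // y < x} := fun p => H' (τ p.1.1 * φ p.1.2) ⟨γ p.1.2, p.2⟩
      have hw : Continuous (Y := Alex {y : P // y < x}) w := by
        refine H.continuous.comp (Continuous.prodMk ?_ ?_)
        · refine (hτ.comp (by fun_prop)).mul ?_
          refine hφ.comp_continuous (by fun_prop) fun p => ?_
          exact fun h => lt_asymm h p.2
        · refine continuous_iff.2 fun p => ?_
          have : Continuous fun p : W => p.1.2 := by fun_prop
          exact this.continuousAt.eventually (hγ p.1.2)
      have hev := continuous_iff.1 hw ⟨(t, k), h1⟩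
      rw [← hW.isOpenEmbedding_subtypeVal.map_nhds_eq ⟨(t, k), h1⟩, Filter.eventually_map]
      filter_upwards [hev] with p hp
      have e : ∀ p : W, G p = (w p).1 := fun p => dif_pos p.2
      change G p ≤ G (⟨(t, k), h1⟩ : W)
      rw [e, e]
      exact hp
    by_cases h2 : γ k = x
    · by_cases ht : (t : ℝ) ≤ 1 / 2
      · have e : G (t, k) = x := by simp only [G, h2, ht, lt_irrefl, dite_false, if_true]
        filter_upwards [hsnd _ t k (hγ k)] with p hp
        rw [e]
        exact hGle p (h2 ▸ hp)
      · have e : G (t, k) = c' := by simp only [G, h2, ht, lt_irrefl, dite_false, if_true, if_false]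
        have ht' : ∀ᶠ p : I × K in 𝓝 (t, k), 1 / 2 < (p.1 : ℝ) := by
          have : Continuous fun p : I × K => (p.1 : ℝ) := by fun_prop
          exact this.continuousAt.eventually (Ioi_mem_nhds (not_le.1 ht))
        filter_upwards [hsnd _ t k (hγ k), hsnd _ t k (hφY k h2), ht'] with p hp hp1 hpt
        rw [e]
        simp only [G]
        split_ifs with h3 h4 h5
        · rw [hp1, hτ1 _ hpt, mul_one, hH1]
        · linarith
        · exact le_rfl
        · exact absurd (lt_of_le_of_ne (h2 ▸ hp) h4) h3
    have e : G (t, k) = γ k := by simp only [G, h1, h2, dite_false, if_false]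
    by_cases h3 : x ≤ γ k
    · filter_upwards [hsnd _ t k (hγ k)] with p hp
      rw [e]
      by_cases h4 : γ p.2 ≤ x
      · exact (hGle p h4).trans h3
      · have : G p = γ p.2 := by
          simp only [G]
          rw [dif_neg fun h => h4 h.le, if_neg fun h => h4 h.le]
        rwa [this]
    · have h4 : ¬ γ k ≤ x := fun h => h1 (lt_of_le_of_ne h h2)
      filter_upwards [hsnd _ t k (hγ k), hsnd _ t k (hφN k h3 h4)] with p hp hp0
      rw [e]
      simp only [G]
      split_ifs with h5 h6 h7
      · rw [hp0, mul_zero, hH0]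
        exact hp
      · exact absurd (h6 ▸ hp) h3
      · exact absurd (h6 ▸ hp) h3
      · exact hp
  refine ⟨⟨G, hG⟩, fun k => ?_, fun k => ?_, fun p hp => ?_⟩
  · change G (0, k) = γ k
    simp only [G]
    split_ifs with h1 h2 h3
    · rw [hτ0, zero_mul, hH0]
    · exact h2.symm
    · norm_num at h3
    · rfl
  · change G (1, k) ≠ x
    simp only [G]
    split_ifs with h1 h2 h3
    · exact (H' (τ 1 * φ k) ⟨γ k, h1⟩).2.ne
    · norm_num at h3
    · exact hc'.ne
    · assumption
  · change G p = x at hp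
    change γ p.2 = x
    by_contra h
    simp only [G, h, if_false] at hp
    split_ifs at hp with h1
    · exact (H' (τ p.1 * φ p.2) ⟨γ p.2, h1⟩).2.ne hp
    · exact h hp

/-- The order isomorphism given by a surjective map reflecting and preserving the order. -/
noncomputable def orderIsoOfSurjective (g : P → Q) (h : ∀ a b, g a ≤ g b ↔ a ≤ b)
    (hs : Function.Surjective g) : P ≃o Q :=
  RelIso.ofSurjective (OrderEmbedding.ofMapLEIff g h) hs

/-- Restrict the codomain of a map avoiding `x`. -/
def codRestrictNe {x : P} {K : Type*} [TopologicalSpace K] (f : C(K, Alex P))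
    (h : ∀ k, f k ≠ x) : C(K, Alex {y : P // y ≠ x}) :=
  ⟨fun k => (⟨f k, h k⟩ : {y : P // y ≠ x}),
    continuous_iff.2 (continuous_iff (P := P) |>.1 f.continuous)⟩

theorem metrizablyTrivial_congr_of_retract (i : P →o Q) (r : Q →o P) (hri : ∀ p, r (i p) = p)
    (hir : ∀ q, q ≤ i (r q)) : MetrizablyTrivial (Alex P) ↔ MetrizablyTrivial (Alex Q) := by
  constructor
  · intro h
    exact h.of_comp_homotopic_id (map r) (map i) (homotopic_of_le _ _ hir).symm
  · intro h
    refine h.of_comp_homotopic_id (map i) (map r) ?_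
    convert ContinuousMap.Homotopic.refl _
    ext p
    exact (hri p).symm

theorem metrizablyTrivial_ne_iff_of_down (x : P) [ContractibleSpace (Alex {y : P // y < x})] :
    MetrizablyTrivial (Alex {y : P // y ≠ x}) ↔ MetrizablyTrivial (Alex P) := by
  let ι : C(Alex {y : P // y ≠ x}, Alex P) := map (OrderHom.Subtype.val _)
  constructor
  · intro h K _ _ g
    obtain ⟨G, hG0, hG1, -⟩ := exists_homotopy_off x g
    let g' : C(K, Alex {y : P // y ≠ x}) :=
      codRestrictNe (G.comp ⟨fun k => (1, k), by fun_prop⟩) hG1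
    obtain ⟨a, ha⟩ := (h K g').comp_right ι
    have : g.Homotopic (ι.comp g') := ⟨⟨G, hG0, fun k => rfl⟩⟩
    exact ⟨a, this.trans ha⟩
  · intro h K _ _ f
    obtain ⟨a, hax, ⟨H⟩⟩ : ∃ a : P, a ≠ x ∧
        (ι.comp f).Homotopic (ContinuousMap.const K (show Alex P from a)) := by
      obtain ⟨a, ha⟩ := h K (ι.comp f)
      by_cases hax : a = x
      · obtain ⟨c⟩ : Nonempty (Alex {y : P // y < x}) := inferInstance
        have hc : c.1 < x := c.2
        refine ⟨c.1, hc.ne, ha.trans (ContinuousMap.Homotopic.symm (homotopic_of_le _ _ ?_))⟩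
        intro k
        exact hc.le.trans_eq hax.symm
      · exact ⟨a, hax, ha⟩
    obtain ⟨G, hG0, hG1, hGx⟩ := exists_homotopy_off x H.toContinuousMap
    have h0 : ∀ t k, G (t, (0, k)) ≠ x := fun t k hx => (f k).2 <| by
      have := hGx _ hx
      exact (H.map_zero_left k).symm.trans this
    have h1 : ∀ t k, G (t, (1, k)) ≠ x := fun t k hx => hax <| by
      have := hGx _ hx
      exact (H.map_one_left k).symm.trans this
    let g0 : C(K, Alex {y : P // y ≠ x}) :=
      codRestrictNe (G.comp ⟨fun k => (1, (0, k)), by fun_prop⟩) fun k => hG1 _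
    let g1 : C(K, Alex {y : P // y ≠ x}) :=
      codRestrictNe (G.comp ⟨fun k => (1, (1, k)), by fun_prop⟩) fun k => hG1 _
    have e1 : f.Homotopic g0 := by
      refine ⟨⟨codRestrictNe (G.comp ⟨fun p : I × K => (p.1, (0, p.2)), by fun_prop⟩)
        fun p => h0 _ _, fun k => Subtype.ext ?_, fun k => rfl⟩⟩
      exact (hG0 (0, k)).trans (H.map_zero_left k)
    have e2 : g0.Homotopic g1 :=
      ⟨⟨codRestrictNe (G.comp ⟨fun p : I × K => (1, p), by fun_prop⟩)
        fun p => hG1 _, fun k => rfl, fun k => rfl⟩⟩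
    have e3 : (ContinuousMap.const K
        (show Alex {y : P // y ≠ x} from (⟨a, hax⟩ : {y : P // y ≠ x}))).Homotopic g1 := by
      refine ⟨⟨codRestrictNe (G.comp ⟨fun p : I × K => (p.1, (1, p.2)), by fun_prop⟩)
        fun p => h1 _ _, fun k => Subtype.ext ?_, fun k => rfl⟩⟩
      exact (hG0 (1, k)).trans (H.map_one_left k)
    exact ⟨_, (e1.trans e2).trans e3.symm⟩

/-- The subset `A \ {x}` as the subspace of points of `A` different from `x`. -/
noncomputable def neOrderIso {A : Set P} (x : A) :
    {y : A // y ≠ x} ≃o (A \ {x.1} : Set P) :=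
  orderIsoOfSurjective (fun y => ⟨y.1.1, y.1.2, fun h => y.2 (Subtype.ext h)⟩)
    (fun _ _ => Iff.rfl) fun y => ⟨⟨⟨y.1, y.2.1⟩, fun h => y.2.2 (congrArg Subtype.val h)⟩, rfl⟩

theorem metrizablyTrivial_diff_iff_of_down {A : Set P} {x : P} (hx : x ∈ A)
    (h : ContractibleSet (hatDown A x)) :
    MetrizablyTrivial (Alex (A \ {x} : Set P)) ↔ MetrizablyTrivial (Alex A) := by
  let e : {y : A // y < ⟨x, hx⟩} ≃o hatDown A x :=
    orderIsoOfSurjective (fun y => ⟨y.1.1, y.1.2, y.2⟩) (fun _ _ => Iff.rfl)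
      fun y => ⟨⟨⟨y.1, y.2.1⟩, y.2.2⟩, rfl⟩
  have h' : ContractibleSpace (Alex (hatDown A x)) := h
  have := (homeomorph e).contractibleSpace
  rw [← metrizablyTrivial_ne_iff_of_down (⟨x, hx⟩ : A)]
  exact (MetrizablyTrivial.congr (homeomorph (neOrderIso (⟨x, hx⟩ : A)))).symm

/-- A monotone map to a finite poset whose preimages of minimal open sets are contractible does
not change `MetrizablyTrivial`. -/
theorem metrizablyTrivial_iff_of_fiber {P Q : Type u} [PartialOrder P] [PartialOrder Q] [Finite Q]
    (f : P →o Q) (hf : ∀ q, ContractibleSpace (Alex {p // f p ≤ q})) :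
    MetrizablyTrivial (Alex P) ↔ MetrizablyTrivial (Alex Q) := by
  classical
  let R : Set (P × Q) := {z | f z.1 ≤ z.2}
  let W := RelCyl P Q R
  let inl : P → W := Sum.inl
  let inr : Q → W := Sum.inr
  have hll : ∀ p p', inl p ≤ inl p' ↔ p ≤ p' := fun _ _ => Iff.rfl
  have hrr : ∀ q q', inr q ≤ inr q' ↔ q ≤ q' := fun _ _ => Iff.rfl
  have hlr : ∀ p q, inl p ≤ inr q ↔ f p ≤ q := fun p q =>
    ⟨fun ⟨x, z, h1, h2, h3⟩ => ((f.monotone h1).trans h3).trans h2,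
      fun h => ⟨p, q, le_rfl, le_rfl, h⟩⟩
  have hrl : ∀ p q, ¬ inr q ≤ inl p := fun _ _ h => h
  let A : Set Q → Set W := fun L => {w | Sum.elim (fun _ => True) (fun q => q ∉ L) w}
  have hAl : ∀ L p, inl p ∈ A L := fun _ _ => trivial
  have hAr : ∀ L q, inr q ∈ A L ↔ q ∉ L := fun _ _ => Iff.rfl
  have key : ∀ L : Set Q, IsLowerSet L →
      (MetrizablyTrivial (Alex (A L)) ↔ MetrizablyTrivial (Alex (A ∅))) := by
    intro L
    induction L using WellFoundedLT.induction with
    | _ L ih =>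
      intro hL
      rcases L.eq_empty_or_nonempty with rfl | hne
      · rfl
      obtain ⟨m, hm⟩ := (Set.toFinite L).exists_maximal hne
      have hlow : IsLowerSet (L \ {m}) := by
        intro a b hba ha
        refine ⟨hL hba ha.1, ?_⟩
        rintro rfl
        exact ha.2 (le_antisymm (hm.2 ha.1 hba) hba)
      rw [← ih (L \ {m}) (Set.sdiff_singleton_ssubset.2 hm.1) hlow]
      have hd : A L = A (L \ {m}) \ {inr m} := by
        ext (p | q)
        · exact ⟨fun h => ⟨h, fun e => Sum.inl_ne_inr e⟩, fun h => h.1⟩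
        · constructor
          · intro h
            refine ⟨fun h' => h h'.1, fun e => h ?_⟩
            rw [Sum.inr_injective e]
            exact hm.1
          · intro h h'
            refine h.1 ⟨h', fun e => h.2 ?_⟩
            rw [Set.mem_singleton_iff.1 e]
            rfl
      rw [hd]
      apply metrizablyTrivial_diff_iff_of_down
      · exact fun h => h.2 rfl
      · let e : {p // f p ≤ m} ≃o hatDown (A (L \ {m})) (inr m) :=
          orderIsoOfSurjective
            (fun p => ⟨inl p.1, hAl _ _, lt_of_le_of_ne ((hlr _ _).2 p.2) Sum.inl_ne_inr⟩)
            (fun _ _ => hll _ _) (by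
              rintro ⟨p | q, hw, hlt⟩
              · exact ⟨⟨p, (hlr _ _).1 hlt.le⟩, rfl⟩
              · refine absurd ⟨hL ((hrr _ _).1 hlt.le) hm.1, fun e => hlt.ne ?_⟩ hw
                rw [Set.mem_singleton_iff.1 e])
        have := hf m
        exact (homeomorph e).symm.contractibleSpace
  have h1 : MetrizablyTrivial (Alex P) ↔ MetrizablyTrivial (Alex (A Set.univ)) :=
    MetrizablyTrivial.congr <| homeomorph <|
      orderIsoOfSurjective (fun p => ⟨inl p, hAl _ _⟩) (fun _ _ => hll _ _) (by
        rintro ⟨p | q, hw⟩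
        · exact ⟨p, rfl⟩
        · exact absurd (Set.mem_univ q) hw)
  have h2 : MetrizablyTrivial (Alex Q) ↔ MetrizablyTrivial (Alex (A ∅)) := by
    refine metrizablyTrivial_congr_of_retract
      ⟨fun q => ⟨inr q, Set.notMem_empty q⟩, fun _ _ h => h⟩
      ⟨fun w => Sum.elim f id w.1, ?_⟩ (fun q => rfl) ?_
    · rintro ⟨p | q, hw⟩ ⟨p' | q', hw'⟩ h
      · exact f.monotone ((hll _ _).1 h)
      · exact (hlr _ _).1 h
      · exact absurd h (hrl _ _)
      · exact (hrr _ _).1 h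
    · rintro ⟨p | q, hw⟩
      · exact (hlr _ _).2 le_rfl
      · exact (hrr _ _).2 le_rfl
  rw [h1, key _ isLowerSet_univ, h2]

/-- A subset `b` of a finite poset `P` meeting every `F_c` in a contractible set has the same
homotopical triviality as the opposite of `P`. -/
theorem metrizablyTrivial_iff_dual {P : Type u} [PartialOrder P] [Finite P] (b : P → Prop)
    (hb : ∀ c, ContractibleSpace (Alex {y // b y ∧ c ≤ y})) :
    MetrizablyTrivial (Alex {y // b y}) ↔ MetrizablyTrivial (Alex Pᵒᵈ) := by
  let T : Type u := {z : Pᵒᵈ × P // b z.2 ∧ OrderDual.ofDual z.1 ≤ z.2}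
  let f₁ : T →o {y // b y} := ⟨fun z => ⟨z.1.2, z.2.1⟩, fun _ _ h => h.2⟩
  let f₂ : T →o Pᵒᵈ := ⟨fun z => z.1.1, fun _ _ h => h.1⟩
  have h₁ : MetrizablyTrivial (Alex T) ↔ MetrizablyTrivial (Alex {y // b y}) := by
    refine metrizablyTrivial_iff_of_fiber f₁ fun q => ?_
    let D := {a : Pᵒᵈ // OrderDual.ofDual a ≤ q.1}
    have : ContractibleSpace (Alex D) :=
      contractibleSpace_of_isLeast (a := (⟨OrderDual.toDual q.1, le_rfl⟩ : D)) fun a => a.2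
    refine contractibleSpace_of_retract (P := D)
      ⟨fun a => ⟨⟨(a.1, q.1), q.2, a.2⟩, le_rfl⟩, fun _ _ h => ⟨h, le_rfl⟩⟩
      ⟨fun z => ⟨z.1.1.1, z.1.2.2.trans z.2⟩, fun _ _ h => h.1⟩ (fun _ => rfl)
      fun z => ⟨le_rfl, z.2⟩
  have h₂ : MetrizablyTrivial (Alex T) ↔ MetrizablyTrivial (Alex Pᵒᵈ) := by
    refine metrizablyTrivial_iff_of_fiber f₂ fun q => ?_
    have := hb (OrderDual.ofDual q)
    refine contractibleSpace_of_retract (P := {y // b y ∧ OrderDual.ofDual q ≤ y})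
      ⟨fun y => ⟨⟨(q, y.1), y.2⟩, le_rfl⟩, fun _ _ h => ⟨le_rfl, h⟩⟩
      ⟨fun z => ⟨z.1.1.2, z.1.2.1, le_trans z.2 z.1.2.2⟩, fun _ _ h => h.2⟩ (fun _ => rfl)
      fun z => ⟨z.2, le_rfl⟩
  exact h₁.symm.trans h₂

theorem metrizablyTrivial_ne_iff_of_up [Finite P] (x : P)
    [hx : ContractibleSpace (Alex {y : P // x < y})] :
    MetrizablyTrivial (Alex {y : P // y ≠ x}) ↔ MetrizablyTrivial (Alex P) := by
  have h₁ := metrizablyTrivial_iff_dual (fun y : P => y ≠ x) fun c => by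
    by_cases hc : c = x
    · subst hc
      let e : {y : P // c < y} ≃o {y : P // y ≠ c ∧ c ≤ y} :=
        orderIsoOfSurjective (fun y => ⟨y.1, y.2.ne', y.2.le⟩) (fun _ _ => Iff.rfl)
          fun y => ⟨⟨y.1, lt_of_le_of_ne y.2.2 y.2.1.symm⟩, rfl⟩
      exact (homeomorph e).symm.contractibleSpace
    · exact contractibleSpace_of_isLeast (a := (⟨c, hc, le_rfl⟩ : {y : P // y ≠ x ∧ c ≤ y}))
        fun y => y.2.2
  have h₂ := metrizablyTrivial_iff_dual (fun _ : P => True) fun c =>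
    contractibleSpace_of_isLeast (a := (⟨c, trivial, le_rfl⟩ : {y : P // True ∧ c ≤ y}))
      fun y => y.2.2
  have h₃ : MetrizablyTrivial (Alex {_y : P // True}) ↔ MetrizablyTrivial (Alex P) :=
    MetrizablyTrivial.congr <| homeomorph <|
      orderIsoOfSurjective (fun y => y.1) (fun _ _ => Iff.rfl) fun y => ⟨⟨y, trivial⟩, rfl⟩
  exact (h₁.trans h₂.symm).trans h₃

theorem metrizablyTrivial_diff_iff_of_up [Finite P] {A : Set P} {x : P} (hx : x ∈ A)
    (h : ContractibleSet (hatUp A x)) :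
    MetrizablyTrivial (Alex (A \ {x} : Set P)) ↔ MetrizablyTrivial (Alex A) := by
  let e : {y : A // ⟨x, hx⟩ < y} ≃o hatUp A x :=
    orderIsoOfSurjective (fun y => ⟨y.1.1, y.1.2, y.2⟩) (fun _ _ => Iff.rfl)
      fun y => ⟨⟨⟨y.1, y.2.1⟩, y.2.2⟩, rfl⟩
  have h' : ContractibleSpace (Alex (hatUp A x)) := h
  have := (homeomorph e).contractibleSpace
  rw [← metrizablyTrivial_ne_iff_of_up (⟨x, hx⟩ : A)]
  exact (MetrizablyTrivial.congr (homeomorph (neOrderIso (⟨x, hx⟩ : A)))).symm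

theorem metrizablyTrivial_of_collapsible [Finite P] {A : Set P} (hA : CollapsibleSet A) :
    MetrizablyTrivial (Alex A) := by
  obtain ⟨x, hx⟩ := hA
  induction hx using Relation.ReflTransGen.head_induction_on with
  | refl =>
    have : Nonempty (Alex ({x} : Set P)) := ⟨⟨x, rfl⟩⟩
    have : Subsingleton (Alex ({x} : Set P)) :=
      inferInstanceAs (Subsingleton ({x} : Set P))
    exact MetrizablyTrivial.of_subsingleton
  | head hstep _ ih =>
    obtain ⟨y, hy, h | h, rfl⟩ := hstep
    · exact (metrizablyTrivial_diff_iff_of_down hy h).1 ih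
    · exact (metrizablyTrivial_diff_iff_of_up hy h).1 ih

end Alex

end

/-- A strong-good cover of a finite T₀-space is a good cover: every
nonempty intersection of elements of the cover is homotopically trivial. -/
theorem stmt_6 {X : Type u} [PartialOrder X] [Finite X] {I : Type v}
    (U : I → Set X) (hopen : ∀ i, IsLowerSet (U i)) (hcover : (⋃ i, U i) = Set.univ)
    (hstrong : ∀ J : Set I, J.Nonempty →
      (⋂ i ∈ J, U i) = ∅ ∨ CollapsibleSet (⋂ i ∈ J, U i)) :
    ∀ J : Set I, J.Nonempty → (⋂ i ∈ J, U i).Nonempty → HTrivialSet (⋂ i ∈ J, U i) := by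
  intro J hJ hne
  rcases hstrong J hJ with h | h
  · exact absurd h hne.ne_empty
  · exact (Alex.metrizablyTrivial_of_collapsible h).hTrivial
end

section
/- Let X be a finite T0-space and let U = {U_i}_{i∈I} be an open cover of X. Let N₀(U) be the subspace of the non-Hausdorff nerve N(U) consisting of those nonempty finite subsets J ⊆ I for which the intersection ⋂_{i∈J} U_i is collapsible, ordered by inclusion. If for every x ∈ X the subspace I_x = {J ∈ N₀(U) : x ∈ ⋂_{i∈J} U_i} of N₀(U) is collapsible, then X and N₀(U) have the same simple homotopy type. -/
/-! ## Finite T₀-spaces as finite posets with the Alexandrov (down-set) topology -/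

universe u v w

/-- `N₀(U)`: the subspace of the non-Hausdorff nerve consisting of the nonempty finite
index sets whose intersection is collapsible, ordered by inclusion. -/
abbrev NerveColl {I : Type u} {X : Type v} [Preorder X] (U : I → Set X) : Type u :=
  {J : Finset I // J.Nonempty ∧ CollapsibleSet (⋂ i ∈ J, U i)}

/-! ## Reducing families of finite sets -/

/-- A reduction of the link of `β` in `F` to the empty family lifts to a reduction of `F` that
removes the star of `β`. -/
theorem CxCollapsesTo.deleteStar {V : Type u} [DecidableEq V] {L : Set (Finset V)}
    (hL : CxCollapsesTo L ∅) (β : Finset V) (hd : ∀ α ∈ L, Disjoint α β) (F : Set (Finset V))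
    (hF : ∀ u, β ⊆ u → (u ∈ F ↔ u \ β ∈ L)) :
    CxCollapsesTo F {u ∈ F | ¬ β ⊆ u} := by
  induction hL using Relation.ReflTransGen.head_induction_on generalizing F with
  | refl =>
    have : {u ∈ F | ¬ β ⊆ u} = F := by
      ext u
      simp only [Set.mem_ofPred_eq, and_iff_left_iff_imp]
      intro hu hb
      exact (hF u hb).1 hu
    rw [this]
    exact Relation.ReflTransGen.refl
  | head h _ ih =>
    obtain ⟨s, t, ⟨hs, ht, hst, hfree⟩, rfl⟩ := h
    have hds := hd s hs
    have hdt := hd t ht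
    have sdiff_eq : ∀ α u : Finset V, Disjoint α β → β ⊆ u → (u \ β = α ↔ u = α ∪ β) := by
      intro α u hα hb
      constructor
      · rintro rfl
        exact (Finset.sdiff_union_of_subset hb).symm
      · rintro rfl
        exact Finset.union_sdiff_cancel_right hα
    have hF' := ih (fun α hα => hd α hα.1) (F \ {s ∪ β, t ∪ β}) (by
      intro u hb
      simp only [Set.mem_sdiff, Set.mem_insert_iff, Set.mem_singleton_iff, hF u hb,
        sdiff_eq s u hds hb, sdiff_eq t u hdt hb])
    have heq : {u ∈ F \ {s ∪ β, t ∪ β} | ¬ β ⊆ u} = {u ∈ F | ¬ β ⊆ u} := by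
      ext u
      simp only [Set.mem_sdiff, Set.mem_insert_iff, Set.mem_singleton_iff, Set.mem_ofPred_eq]
      constructor
      · rintro ⟨⟨h1, -⟩, h2⟩
        exact ⟨h1, h2⟩
      · rintro ⟨h1, h2⟩
        refine ⟨⟨h1, ?_⟩, h2⟩
        rintro (rfl | rfl) <;> exact h2 Finset.subset_union_right
    rw [heq] at hF'
    refine Relation.ReflTransGen.head ⟨s ∪ β, t ∪ β, ⟨?_, ?_, ?_, ?_⟩, rfl⟩ hF'
    · rw [hF _ Finset.subset_union_right, Finset.union_sdiff_cancel_right hds]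
      exact hs
    · rw [hF _ Finset.subset_union_right, Finset.union_sdiff_cancel_right hdt]
      exact ht
    · refine Finset.ssubset_iff_subset_ne.2
        ⟨Finset.union_subset_union_left hst.subset, fun h => hst.ne ?_⟩
      rw [← Finset.union_sdiff_cancel_right hds, h, Finset.union_sdiff_cancel_right hdt]
    · intro u hu hsu
      have hb : β ⊆ u := Finset.subset_union_right.trans hsu.subset
      rw [← sdiff_eq t u hdt hb]
      refine hfree _ ((hF u hb).1 hu) (Finset.ssubset_iff_subset_ne.2 ⟨?_, fun h => ?_⟩)
      · exact Finset.subset_sdiff.2 ⟨Finset.subset_union_left.trans hsu.subset, hds⟩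
      · exact hsu.ne ((sdiff_eq s u hds hb).1 h.symm).symm

/-- If the sections over `W` of all members of `K` containing `x` reduce to the empty family, then
`K` reduces to the family of its members not containing `x`. -/
theorem CxCollapsesTo.deleteVertex {V : Type u} [Finite V] [DecidableEq V] (W : Set V)
    [DecidablePred (· ∉ W)] {x : V} (hx : x ∉ W) (K : Set (Finset V))
    (h : ∀ u ∈ K, x ∈ u →
      CxCollapsesTo {α : Finset V | (∀ a ∈ α, a ∈ W) ∧ α ∪ u.filter (· ∉ W) ∈ K} ∅) :
    CxCollapsesTo K {u ∈ K | x ∉ u} := by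
  induction hn : K.ncard using Nat.strong_induction_on generalizing K with
  | _ n ih =>
    subst hn
    rcases Set.eq_empty_or_nonempty {u ∈ K | x ∈ u} with hE | hE
    · have : {u ∈ K | x ∉ u} = K := by
        ext u
        simp only [Set.mem_ofPred_eq, and_iff_left_iff_imp]
        exact fun hu hxu => Set.eq_empty_iff_forall_notMem.1 hE u ⟨hu, hxu⟩
      rw [this]
      exact Relation.ReflTransGen.refl
    · obtain ⟨w, ⟨hwK, hxw⟩, hmax⟩ := Set.Finite.exists_maximalFor
        (fun u : Finset V => u.filter (· ∉ W)) {u ∈ K | x ∈ u} (Set.toFinite _) hE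
      set β := w.filter (· ∉ W) with hβ
      have hxβ : x ∈ β := by simp [hβ, hxw, hx]
      have hβW : ∀ b ∈ β, b ∉ W := fun b hb => (Finset.mem_filter.1 hb).2
      have key : ∀ u ∈ K, β ⊆ u → u.filter (· ∉ W) = β := by
        intro u hu hb
        have hsub : β ⊆ u.filter (· ∉ W) := fun b hbb =>
          Finset.mem_filter.2 ⟨hb hbb, hβW b hbb⟩
        exact (hmax ⟨hu, hb hxβ⟩ hsub).antisymm hsub
      have h1 := (h w hwK hxw).deleteStar β
        (fun α hα => Finset.disjoint_left.2 fun a ha hab => hβW a hab (hα.1 a ha)) K (by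
          intro u hb
          simp only [Set.mem_ofPred_eq, ← hβ, Finset.sdiff_union_of_subset hb]
          refine ⟨fun hu => ⟨fun a ha => ?_, hu⟩, fun hu => hu.2⟩
          by_contra haW
          obtain ⟨ha1, ha2⟩ := Finset.mem_sdiff.1 ha
          exact ha2 (key u hu hb ▸ Finset.mem_filter.2 ⟨ha1, haW⟩))
      have hlt : {u ∈ K | ¬ β ⊆ u}.ncard < K.ncard := by
        refine Set.ncard_lt_ncard ⟨fun u hu => hu.1, fun hh => ?_⟩ (Set.toFinite _)
        exact (hh hwK).2 (Finset.filter_subset _ _)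
      have h2 := ih _ hlt {u ∈ K | ¬ β ⊆ u} (by
        rintro u ⟨huK, hu⟩ hxu
        convert h u huK hxu using 1
        ext α
        simp only [Set.mem_ofPred_eq, and_congr_right_iff, and_iff_left_iff_imp]
        intro hα _ hb
        refine hu fun b hbb => ?_
        rcases Finset.mem_union.1 (hb hbb) with hba | hba
        · exact absurd (hα b hba) (hβW b hbb)
        · exact (Finset.mem_filter.1 hba).1) rfl
      have heq : {u ∈ {u ∈ K | ¬ β ⊆ u} | x ∉ u} = {u ∈ K | x ∉ u} := by
        ext u
        simp only [Set.mem_ofPred_eq]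
        exact ⟨fun hu => ⟨hu.1.1, hu.2⟩, fun hu => ⟨⟨hu.1, fun hb => hu.2 (hb hxβ)⟩, hu.2⟩⟩
      rw [heq] at h2
      exact h1.trans h2

/-- The family of all finite chains, including the empty one, with elements in `A`. -/
def chains {P : Type u} [Preorder P] (A : Set P) : Set (Finset P) :=
  {s | ↑s ⊆ A ∧ IsChain (· ≤ ·) (s : Set P)}

theorem chains_deleteVertex {P : Type u} [PartialOrder P] [Finite P] {A W : Set P} {x : P}
    (hx : x ∉ W) (hW : W ⊆ A)
    (hcomp : ∀ y ∈ A, y ∉ W → (y ≤ x ∨ x ≤ y) → ∀ w ∈ W, w ≤ y ∨ y ≤ w)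
    (h : CxCollapsesTo (chains W) ∅) :
    CxCollapsesTo (chains A) (chains (A \ {x})) := by
  classical
  have key := CxCollapsesTo.deleteVertex W hx (chains A) (by
    intro u hu hxu
    convert h using 1
    ext α
    constructor
    · rintro ⟨h1, h2⟩
      exact ⟨h1, h2.2.mono (by simp)⟩
    · rintro ⟨h1, h2⟩
      refine ⟨fun a ha => h1 ha, ?_, ?_⟩
      · intro a ha
        rcases Finset.mem_union.1 (Finset.mem_coe.1 ha) with ha | ha
        · exact hW (h1 ha)
        · exact hu.1 (Finset.mem_filter.1 ha).1
      · have hc : ∀ y ∈ u.filter (· ∉ W), ∀ w ∈ W, w ≤ y ∨ y ≤ w := by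
          intro y hy
          obtain ⟨hy1, hy2⟩ := Finset.mem_filter.1 hy
          exact hcomp y (hu.1 hy1) hy2 (hu.2.total hy1 hxu)
        intro a ha b hb hab
        rcases Finset.mem_union.1 (Finset.mem_coe.1 ha) with ha | ha <;>
          rcases Finset.mem_union.1 (Finset.mem_coe.1 hb) with hb | hb
        · exact h2 ha hb hab
        · exact hc b hb a (h1 ha)
        · exact (hc a ha b (h1 hb)).symm
        · exact hu.2 (Finset.mem_filter.1 ha).1 (Finset.mem_filter.1 hb).1 hab)
  convert key using 1
  ext s
  simp only [chains, Set.mem_ofPred_eq, Set.subset_sdiff, Set.disjoint_singleton_right,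
    Finset.mem_coe]
  tauto

theorem chains_deleteVertex_of_hatDown {P : Type u} [PartialOrder P] [Finite P] {A : Set P}
    {x : P} (h : CxCollapsesTo (chains (hatDown A x)) ∅) :
    CxCollapsesTo (chains A) (chains (A \ {x})) := by
  refine chains_deleteVertex (fun hx => lt_irrefl x hx.2) (fun y hy => hy.1) ?_ h
  intro y hy hyW hxy w hw
  rcases hxy with hxy | hxy
  · rcases hxy.eq_or_lt with rfl | hlt
    · exact Or.inl hw.2.le
    · exact absurd ⟨hy, hlt⟩ hyW
  · exact Or.inl (hw.2.le.trans hxy)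

theorem chains_deleteVertex_of_hatUp {P : Type u} [PartialOrder P] [Finite P] {A : Set P}
    {x : P} (h : CxCollapsesTo (chains (hatUp A x)) ∅) :
    CxCollapsesTo (chains A) (chains (A \ {x})) := by
  refine chains_deleteVertex (fun hx => lt_irrefl x hx.2) (fun y hy => hy.1) ?_ h
  intro y hy hyW hxy w hw
  rcases hxy with hxy | hxy
  · exact Or.inr (hxy.trans hw.2.le)
  · rcases hxy.eq_or_lt with rfl | hlt
    · exact Or.inr hw.2.le
    · exact absurd ⟨hy, hlt⟩ hyW

theorem chains_singleton_collapsesTo {P : Type u} [PartialOrder P] (x : P) :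
    CxCollapsesTo (chains ({x} : Set P)) ∅ := by
  have h : chains ({x} : Set P) = {∅, {x}} := by
    ext s
    simp only [chains, Set.mem_ofPred_eq, Set.mem_insert_iff, Set.mem_singleton_iff]
    rw [← Finset.coe_singleton, Finset.coe_subset, Finset.subset_singleton_iff]
    constructor
    · exact fun h => h.1
    · rintro (rfl | rfl) <;> simp
  refine Relation.ReflTransGen.single ⟨∅, {x}, ⟨?_, ?_, ?_, ?_⟩, ?_⟩
  · simp [h]
  · simp [h]
  · exact Finset.empty_ssubset_singleton
  · intro u hu hne
    rw [h] at hu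
    rcases hu with rfl | hu
    · exact absurd hne (ssubset_irrefl _)
    · exact hu
  · rw [h, Set.sdiff_self]

theorem chains_collapsesTo_of_isGreatest {P : Type u} [PartialOrder P] [Finite P] {A : Set P}
    {m : P} (h : IsGreatest A m) : CxCollapsesTo (chains A) ∅ := by
  induction hn : A.ncard using Nat.strong_induction_on generalizing A with
  | _ n ih =>
    subst hn
    by_cases hA : ∃ y ∈ A, y ≠ m
    · obtain ⟨y, hy, hym⟩ := hA
      have hlt : (A \ {y}).ncard < A.ncard := Set.ncard_sdiff_singleton_lt_of_mem hy
      have hsub : hatUp A y ⊆ A \ {y} := fun z hz => ⟨hz.1, hz.2.ne'⟩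
      refine (chains_deleteVertex_of_hatUp (ih _ ((Set.ncard_le_ncard hsub).trans_lt hlt)
        ⟨⟨h.1, lt_of_le_of_ne (h.2 hy) hym⟩, fun z hz => h.2 hz.1⟩ rfl)).trans
        (ih _ hlt ⟨⟨h.1, fun e => hym e.symm⟩, fun z hz => h.2 hz.1⟩ rfl)
    · push Not at hA
      rw [Set.eq_singleton_iff_unique_mem.2 ⟨h.1, hA⟩]
      exact chains_singleton_collapsesTo m

theorem chains_collapsesTo_of_isLeast {P : Type u} [PartialOrder P] [Finite P] {A : Set P}
    {m : P} (h : IsLeast A m) : CxCollapsesTo (chains A) ∅ := by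
  induction hn : A.ncard using Nat.strong_induction_on generalizing A with
  | _ n ih =>
    subst hn
    by_cases hA : ∃ y ∈ A, y ≠ m
    · obtain ⟨y, hy, hym⟩ := hA
      have hlt : (A \ {y}).ncard < A.ncard := Set.ncard_sdiff_singleton_lt_of_mem hy
      have hsub : hatDown A y ⊆ A \ {y} := fun z hz => ⟨hz.1, hz.2.ne⟩
      refine (chains_deleteVertex_of_hatDown (ih _ ((Set.ncard_le_ncard hsub).trans_lt hlt)
        ⟨⟨h.1, lt_of_le_of_ne (h.2 hy) hym.symm⟩, fun z hz => h.2 hz.1⟩ rfl)).trans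
        (ih _ hlt ⟨⟨h.1, fun e => hym e.symm⟩, fun z hz => h.2 hz.1⟩ rfl)
    · push Not at hA
      rw [Set.eq_singleton_iff_unique_mem.2 ⟨h.1, hA⟩]
      exact chains_singleton_collapsesTo m

/-! ## Contractible finite spaces -/

theorem alexTop.continuous_iff {P : Type u} {Q : Type v} [Preorder P] [Preorder Q] {f : P → Q} :
    @Continuous P Q (alexTop P) (alexTop Q) f ↔ Monotone f := by
  let := alexTop P
  let := alexTop Q
  constructor
  · intro hf a b hab
    exact (hf.isOpen_preimage (Set.Iic (f b)) (isLowerSet_Iic _) : IsLowerSet _) hab le_rfl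
  · intro hf
    exact ⟨fun s hs => IsLowerSet.preimage hs hf⟩

/-- The identity of `Q` is joined to a constant map by a fence of order-preserving maps. -/
def FenceContractible (Q : Type u) [Preorder Q] : Prop :=
  ∃ c : Q, Relation.EqvGen (· ≤ ·) (OrderHom.id : Q →o Q) (OrderHom.const Q c)

theorem FenceContractible.of_contractibleSpace {Q : Type u} [PartialOrder Q] [Finite Q]
    (h : @ContractibleSpace Q (alexTop Q)) : FenceContractible Q := by
  let := alexTop Q
  obtain ⟨c, ⟨F⟩⟩ := (contractible_iff_id_nullhomotopic Q).1 h
  refine ⟨c, ?_⟩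
  let g : unitInterval → (Q →o Q) := fun t =>
    ⟨fun a => F (t, a), alexTop.continuous_iff.1
      (F.continuous.comp (Continuous.prodMk continuous_const continuous_id))⟩
  have hnear : ∀ t, {t' | g t' ≤ g t} ∈ nhds t := by
    intro t
    have hopen : IsOpen {t' | g t' ≤ g t} := by
      have : {t' | g t' ≤ g t} = ⋂ a, (fun t' => F (t', a)) ⁻¹' Set.Iic (g t a) := by
        ext t'
        simp only [Set.mem_iInter]
        exact Iff.rfl
      rw [this]
      refine isOpen_iInter_of_finite fun a => ?_
      exact (F.continuous.comp (Continuous.prodMk continuous_id continuous_const)).isOpen_preimage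
        _ (isLowerSet_Iic (g t a))
    exact hopen.mem_nhds (le_refl (g t))
  have hclopen : IsClopen {t | Relation.EqvGen (· ≤ ·) (g 0) (g t)} := by
    constructor
    · rw [← isOpen_compl_iff, isOpen_iff_mem_nhds]
      intro t ht
      filter_upwards [hnear t] with t' ht' h'
      exact ht (h'.trans _ _ _ (.rel _ _ ht'))
    · rw [isOpen_iff_mem_nhds]
      intro t ht
      filter_upwards [hnear t] with t' ht'
      exact Relation.EqvGen.trans _ _ _ ht (.symm _ _ (.rel _ _ ht'))
  have h1 : (1 : unitInterval) ∈ {t | Relation.EqvGen (· ≤ ·) (g 0) (g t)} := by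
    rw [hclopen.eq_univ ⟨0, .refl _⟩]
    trivial
  have e0 : g 0 = OrderHom.id := by
    ext a
    exact F.map_zero_left a
  have e1 : g 1 = OrderHom.const Q c := by
    ext a
    exact F.map_one_left a
  rw [← e0, ← e1]
  exact h1

theorem FenceContractible.retract {Q : Type u} {Q' : Type v} [Preorder Q] [Preorder Q']
    (h : FenceContractible Q) (i : Q' →o Q) (r : Q →o Q') (hri : ∀ a, r (i a) = a) :
    FenceContractible Q' := by
  obtain ⟨c, hc⟩ := h
  refine ⟨r c, ?_⟩
  have key : ∀ f g : Q →o Q, Relation.EqvGen (· ≤ ·) f g →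
      Relation.EqvGen (· ≤ ·) (r.comp (f.comp i)) (r.comp (g.comp i)) := by
    intro f g hfg
    induction hfg with
    | rel f g h => exact .rel _ _ fun a => r.monotone (h (i a))
    | refl => exact .refl _
    | symm _ _ _ ih => exact .symm _ _ ih
    | trans _ _ _ _ _ ih1 ih2 => exact .trans _ _ _ ih1 ih2
  have hid : r.comp (OrderHom.id.comp i) = OrderHom.id := OrderHom.ext _ _ (funext hri)
  exact hid ▸ key _ _ hc

/-- A nontrivial finite poset whose identity is joined to a constant map by a fence has a beat
point. -/
theorem FenceContractible.exists_beat_point {Q : Type u} [PartialOrder Q] [Finite Q]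
    [Nontrivial Q] (h : FenceContractible Q) :
    ∃ x m : Q, IsGreatest (Set.Iio x) m ∨ IsLeast (Set.Ioi x) m := by
  by_contra! hno
  have hup : ∀ f : Q →o Q, OrderHom.id ≤ f → f = OrderHom.id := by
    intro f hf
    by_contra hne
    have hS : {x | f x ≠ x}.Nonempty := by
      by_contra hS
      refine hne (OrderHom.ext _ _ (funext fun x => ?_))
      by_contra hx
      exact hS ⟨x, hx⟩
    obtain ⟨x, hx, hmax⟩ := Set.Finite.exists_maximal (Set.toFinite _) hS
    refine (hno x (f x)).2 ⟨lt_of_le_of_ne (hf x) (Ne.symm hx), fun y hy => ?_⟩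
    have hfy : f y = y := by
      by_contra hfy
      exact hy.not_ge (hmax hfy hy.le)
    exact hfy ▸ f.monotone hy.le
  have hdown : ∀ f : Q →o Q, f ≤ OrderHom.id → f = OrderHom.id := by
    intro f hf
    by_contra hne
    have hS : {x | f x ≠ x}.Nonempty := by
      by_contra hS
      refine hne (OrderHom.ext _ _ (funext fun x => ?_))
      by_contra hx
      exact hS ⟨x, hx⟩
    obtain ⟨x, hx, hmin⟩ := Set.Finite.exists_minimal (Set.toFinite _) hS
    refine (hno x (f x)).1 ⟨lt_of_le_of_ne (hf x) hx, fun y hy => ?_⟩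
    have hfy : f y = y := by
      by_contra hfy
      exact hy.not_ge (hmin hfy hy.le)
    exact hfy ▸ f.monotone hy.le
  have key : ∀ f g : Q →o Q, Relation.EqvGen (· ≤ ·) f g →
      (f = OrderHom.id ↔ g = OrderHom.id) := by
    intro f g hfg
    induction hfg with
    | rel f g h =>
      exact ⟨fun e => hup g (e ▸ h), fun e => hdown f (e ▸ h)⟩
    | refl => exact Iff.rfl
    | symm _ _ _ ih => exact ih.symm
    | trans _ _ _ _ _ ih1 ih2 => exact ih1.trans ih2
  obtain ⟨c, hc⟩ := h
  have hconst := (key _ _ hc).1 rfl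
  obtain ⟨a, b, hab⟩ := exists_pair_ne Q
  exact hab ((DFunLike.congr_fun hconst a).symm.trans (DFunLike.congr_fun hconst b))

theorem FenceContractible.diff_singleton {P : Type u} [PartialOrder P] {A : Set P} {x m : A}
    (h : FenceContractible A) (hm : IsGreatest (Set.Iio x) m ∨ IsLeast (Set.Ioi x) m) :
    FenceContractible ↑(A \ {(x : P)}) := by
  classical
  have hmx : m ≠ x := by
    rcases hm with hm | hm
    · exact ne_of_lt hm.1
    · exact ne_of_gt hm.1
  refine h.retract ⟨fun a => ⟨a, a.2.1⟩, fun a b hab => hab⟩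
    ⟨fun a => if ha : a = x then
        ⟨m, Set.mem_sdiff_singleton.2 ⟨m.2, fun e => hmx (Subtype.ext e)⟩⟩
      else ⟨a, Set.mem_sdiff_singleton.2 ⟨a.2, fun e => ha (Subtype.ext e)⟩⟩, ?_⟩ ?_
  · intro a b hab
    by_cases ha : a = x <;> by_cases hb : b = x
    · simp [ha, hb]
    · have hxb : x < b := lt_of_le_of_ne (ha ▸ hab) (Ne.symm hb)
      have : m ≤ b := by
        rcases hm with hm | hm
        · exact (lt_trans hm.1 hxb).le
        · exact hm.2 hxb
      simpa [ha, hb, ← Subtype.coe_le_coe] using this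
    · have hax : a < x := lt_of_le_of_ne (hb ▸ hab) ha
      have : a ≤ m := by
        rcases hm with hm | hm
        · exact hm.2 hax
        · exact (lt_trans hax hm.1).le
      simpa [ha, hb, ← Subtype.coe_le_coe] using this
    · simpa [ha, hb, ← Subtype.coe_le_coe] using hab
  · rintro ⟨a, haA, hax⟩
    have : (⟨a, haA⟩ : A) ≠ x := fun e => hax (congrArg Subtype.val e)
    exact dif_neg this

theorem FenceContractible.chains_collapsesTo {P : Type u} [PartialOrder P] [Finite P] {A : Set P}
    (h : FenceContractible A) : CxCollapsesTo (chains A) ∅ := by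
  induction hn : A.ncard using Nat.strong_induction_on generalizing A with
  | _ n ih =>
    subst hn
    rcases subsingleton_or_nontrivial A with hA | hA
    · obtain ⟨c, -⟩ := h
      exact chains_collapsesTo_of_isGreatest (m := c)
        ⟨c.2, fun y hy => (congrArg Subtype.val (hA.elim ⟨y, hy⟩ c)).le⟩
    · obtain ⟨x, m, hm⟩ := h.exists_beat_point
      refine Relation.ReflTransGen.trans ?_ (ih _ (Set.ncard_sdiff_singleton_lt_of_mem x.2)
        (h.diff_singleton hm) rfl)
      rcases hm with hm | hm
      · exact chains_deleteVertex_of_hatDown (chains_collapsesTo_of_isGreatest (m := (m : P))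
          ⟨⟨m.2, hm.1⟩, fun y hy => hm.2 (show (⟨y, hy.1⟩ : A) < x from hy.2)⟩)
      · exact chains_deleteVertex_of_hatUp (chains_collapsesTo_of_isLeast (m := (m : P))
          ⟨⟨m.2, hm.1⟩, fun y hy => hm.2 (show x < (⟨y, hy.1⟩ : A) from hy.2)⟩)

theorem ContractibleSet.chains_collapsesTo {P : Type u} [PartialOrder P] [Finite P] {A : Set P}
    (h : ContractibleSet A) : CxCollapsesTo (chains A) ∅ :=
  (FenceContractible.of_contractibleSpace h).chains_collapsesTo

theorem CollapsibleSet.chains_collapsesTo {P : Type u} [PartialOrder P] [Finite P] {A : Set P}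
    (h : CollapsibleSet A) : CxCollapsesTo (chains A) ∅ := by
  obtain ⟨x, h⟩ := h
  induction h using Relation.ReflTransGen.head_induction_on with
  | refl => exact chains_singleton_collapsesTo x
  | head h _ ih =>
    obtain ⟨y, -, h | h, rfl⟩ := h
    · exact (chains_deleteVertex_of_hatDown h.chains_collapsesTo).trans ih
    · exact (chains_deleteVertex_of_hatUp h.chains_collapsesTo).trans ih

theorem ContinuousMap.homotopic_of_le {P : Type u} {Q : Type v} [TopologicalSpace P] [Preorder Q]
    (f g : @ContinuousMap P Q _ (alexTop Q)) (h : ∀ a, f a ≤ g a) :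
    @ContinuousMap.Homotopic P Q _ (alexTop Q) f g := by
  classical
  let := alexTop Q
  refine ⟨⟨⟨fun p => if p.1 = 1 then g p.2 else f p.2, ⟨fun s hs => ?_⟩⟩, ?_, ?_⟩⟩
  · have hs' : IsLowerSet s := hs
    have : (fun p : unitInterval × P => if p.1 = 1 then g p.2 else f p.2) ⁻¹' s =
        ({1}ᶜ ×ˢ (f ⁻¹' s)) ∪ (Set.univ ×ˢ (g ⁻¹' s)) := by
      ext ⟨t, a⟩
      by_cases ht : t = 1
      · simp [ht]
      · simp only [Set.mem_preimage, ht, if_false, Set.mem_union, Set.mem_prod,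
          Set.mem_compl_iff, Set.mem_singleton_iff, not_false_eq_true, true_and, Set.mem_univ]
        exact ⟨Or.inl, fun h' => h'.elim id fun h' => hs' (h a) h'⟩
    rw [this]
    exact (isOpen_compl_singleton.prod (hs.preimage f.continuous)).union
      (isOpen_univ.prod (hs.preimage g.continuous))
  · intro a
    simp
  · intro a
    simp

/-- A subset of a poset is contractible if every element has a join, within the subset, with a
fixed element `c`. -/
theorem ContractibleSet.of_joins {P : Type u} [Preorder P] {A : Set P} {c : P} (hc : c ∈ A)
    (h : ∀ a ∈ A, ∃ b, IsLeast {z ∈ A | a ≤ z ∧ c ≤ z} b) : ContractibleSet A := by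
  choose! f hf using h
  let := alexTop A
  have hcont : Continuous fun a : A => (⟨f a, (hf a a.2).1.1⟩ : A) :=
    alexTop.continuous_iff.2 fun a b hab =>
      (hf a a.2).2 ⟨(hf b b.2).1.1, le_trans hab (hf b b.2).1.2.1, (hf b b.2).1.2.2⟩
  have h1 : (ContinuousMap.id A).Homotopic ⟨_, hcont⟩ :=
    ContinuousMap.homotopic_of_le _ _ fun a => (hf a a.2).1.2.1
  have h2 : (ContinuousMap.const A (⟨c, hc⟩ : A)).Homotopic ⟨_, hcont⟩ :=
    ContinuousMap.homotopic_of_le _ _ fun a => (hf a a.2).1.2.2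
  exact (contractible_iff_id_nullhomotopic A).2 ⟨_, h1.trans h2.symm⟩

theorem ContractibleSet.of_isGreatest {P : Type u} [Preorder P] {A : Set P} {m : P}
    (h : IsGreatest A m) : ContractibleSet A :=
  .of_joins h.1 fun _ ha => ⟨m, ⟨h.1, h.2 ha, le_rfl⟩, fun _ hz => hz.2.2⟩

theorem ContractibleSet.of_isLeast {P : Type u} [Preorder P] {A : Set P} {m : P}
    (h : IsLeast A m) : ContractibleSet A :=
  .of_joins h.1 fun a ha => ⟨a, ⟨ha, le_rfl, h.2 ha⟩, fun _ hz => hz.2.1⟩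

theorem ContractibleSet.congr {P : Type u} {Q : Type v} [Preorder P] [Preorder Q] {A : Set P}
    {B : Set Q} (e : A ≃o B) (h : ContractibleSet A) : ContractibleSet B := by
  let := alexTop A
  let := alexTop B
  have : ContractibleSpace A := h
  let e' : B ≃ₜ A := ⟨e.symm.toEquiv, alexTop.continuous_iff.2 e.symm.monotone,
    alexTop.continuous_iff.2 e.monotone⟩
  exact e'.contractibleSpace

/-! ## Simple homotopy equivalences of finite posets -/

/-- An order embedding restricts to an order isomorphism of a subset onto its image. -/
noncomputable def OrderEmbedding.imageIso {P : Type u} {Q : Type v} [Preorder P] [Preorder Q]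
    (e : P ↪o Q) (A : Set P) : A ≃o e '' A where
  toEquiv := Equiv.Set.image e A e.injective
  map_rel_iff' := e.le_iff_le

theorem SHE.of_orderIso {P Q : Type u} [PartialOrder P] [PartialOrder Q] [Finite P] [Finite Q]
    (e : P ≃o Q) : SHE (FinPoset.mk P) (FinPoset.mk Q) :=
  .rel _ _ ⟨Set.univ, Relation.ReflTransGen.refl, ⟨e.symm.trans OrderIso.Set.univ.symm⟩⟩

theorem SHE.of_collapseStep {P : Type u} [PartialOrder P] [Finite P] {A B : Set P}
    (h : CollapseStep A B) : SHE (FinPoset.mk A) (FinPoset.mk B) := by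
  obtain ⟨x, hx, hw, rfl⟩ := h
  let e : A ↪o P := OrderEmbedding.subtype (· ∈ A)
  refine .rel _ _ ⟨Set.univ \ {⟨x, hx⟩}, .single ⟨⟨x, hx⟩, trivial, ?_, rfl⟩, ?_⟩
  · refine hw.imp (fun h => ?_) (fun h => ?_)
    · refine ContractibleSet.congr (e.imageIso _).symm ?_
      convert h using 1
      ext y
      constructor
      · rintro ⟨z, hz, rfl⟩
        exact ⟨z.2, hz.2⟩
      · rintro ⟨hy, hyx⟩
        exact ⟨⟨y, hy⟩, ⟨trivial, hyx⟩, rfl⟩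
    · refine ContractibleSet.congr (e.imageIso _).symm ?_
      convert h using 1
      ext y
      constructor
      · rintro ⟨z, hz, rfl⟩
        exact ⟨z.2, hz.2⟩
      · rintro ⟨hy, hyx⟩
        exact ⟨⟨y, hy⟩, ⟨trivial, hyx⟩, rfl⟩
  · have he : e '' (Set.univ \ {⟨x, hx⟩}) = A \ {x} := by
      ext y
      constructor
      · rintro ⟨z, hz, rfl⟩
        exact ⟨z.2, fun e => hz.2 (Subtype.ext e)⟩
      · rintro ⟨hy, hyx⟩
        exact ⟨⟨y, hy⟩, ⟨trivial, fun e => hyx (congrArg Subtype.val e)⟩, rfl⟩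
    exact ⟨((e.imageIso _).trans (OrderIso.setCongr _ _ he)).symm⟩

theorem SHE.of_collapsesToSet {P : Type u} [PartialOrder P] [Finite P] {A B : Set P}
    (h : CollapsesToSet A B) : SHE (FinPoset.mk A) (FinPoset.mk B) := by
  induction h with
  | refl => exact .refl _
  | tail _ h ih => exact .trans _ _ _ ih (SHE.of_collapseStep h)

/-- A reduction of simplicial complexes induces a collapse of their face posets. -/
theorem CxCollapsesTo.collapsesToSet {V : Type u} {F G : Set (Finset V)}
    (h : CxCollapsesTo F G) (hF : IsLowerSet F) (hG : ∅ ∈ G) :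
    CollapsesToSet (F \ {∅}) (G \ {∅}) := by
  classical
  have hsub : ∀ {F G : Set (Finset V)}, CxCollapsesTo F G → G ⊆ F := by
    intro F G h
    induction h with
    | refl => exact subset_rfl
    | tail _ h ih =>
      obtain ⟨s, t, -, rfl⟩ := h
      exact Set.sdiff_subset.trans ih
  induction h using Relation.ReflTransGen.head_induction_on with
  | refl => exact Relation.ReflTransGen.refl
  | @head F F' h h' ih =>
    have hF'0 : ∅ ∈ F' := hsub h' hG
    obtain ⟨s, t, ⟨hs, ht, hst, hfree⟩, rfl⟩ := h
    have hs0 : s ≠ ∅ := fun e => hF'0.2 (Or.inl e.symm)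
    have ht0 : t ≠ ∅ := fun e => hF'0.2 (Or.inr e.symm)
    have hlower : IsLowerSet (F \ {s, t}) := by
      rintro a b hba ⟨ha, hast⟩
      refine ⟨hF hba ha, ?_⟩
      rintro (rfl | rfl)
      · refine hast ((eq_or_ne b a).imp Eq.symm fun hne => ?_)
        exact hfree a ha (lt_of_le_of_ne hba hne)
      · refine hast (Or.inr (hfree a ha (hst.trans_le hba)))
    refine Relation.ReflTransGen.head (b := (F \ {∅}) \ {s}) ?_
      (Relation.ReflTransGen.head ?_ (ih hlower))
    · refine ⟨s, ⟨hs, hs0⟩, Or.inr (.of_isGreatest (m := t) ⟨⟨⟨ht, ht0⟩, hst⟩, ?_⟩), rfl⟩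
      exact fun u hu => (hfree u hu.1.1 hu.2).le
    · refine ⟨t, ⟨⟨ht, ht0⟩, hst.ne'⟩, Or.inl ?_, ?_⟩
      · obtain ⟨v, hvt, hvs⟩ := Finset.exists_of_ssubset hst
        have hts : t = insert v s := by
          refine (hfree _ (hF ?_ ht) (Finset.ssubset_insert hvs)).symm
          exact Finset.insert_subset hvt hst.subset
        refine .of_joins (c := {v}) ?_ ?_
        · have hvt' : {v} ⊆ t := Finset.singleton_subset_iff.2 hvt
          refine ⟨⟨⟨hF hvt' ht, Finset.singleton_ne_empty v⟩, ?_⟩, lt_of_le_of_ne hvt' ?_⟩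
          · exact fun e => hvs (e ▸ Finset.mem_singleton_self v)
          · intro e
            obtain ⟨w, hw⟩ := Finset.nonempty_iff_ne_empty.2 hs0
            have hwv := Finset.mem_singleton.1 (e ▸ hst.subset hw)
            exact hvs (hwv ▸ hw)
        · rintro a ⟨⟨⟨haF, ha0⟩, has⟩, hat⟩
          have hsub : insert v a ⊆ t := Finset.insert_subset hvt hat.le
          refine ⟨insert v a, ⟨⟨⟨⟨hF hsub ht, Finset.insert_ne_empty v a⟩, ?_⟩,
            lt_of_le_of_ne hsub ?_⟩, Finset.subset_insert v a, ?_⟩, ?_⟩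
          · exact fun e => hvs (e ▸ Finset.mem_insert_self v a)
          · intro e
            have hva : v ∉ a := fun hva => hat.ne (Finset.insert_eq_of_mem hva ▸ e)
            refine has ?_
            rw [Set.mem_singleton_iff, ← Finset.erase_insert hva, e, hts,
              Finset.erase_insert hvs]
          · exact Finset.singleton_subset_iff.2 (Finset.mem_insert_self v a)
          · rintro z ⟨-, hz1, hz2⟩
            exact Finset.insert_subset (Finset.singleton_subset_iff.1 hz2) hz1
      · ext u
        simp only [Set.mem_sdiff, Set.mem_insert_iff, Set.mem_singleton_iff]
        tauto

theorem CxCollapsesTo.map {V W : Type u} (f : V ↪ W) {F G : Set (Finset V)}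
    (h : CxCollapsesTo F G) : CxCollapsesTo (Finset.map f '' F) (Finset.map f '' G) := by
  induction h with
  | refl => exact Relation.ReflTransGen.refl
  | tail _ h ih =>
    refine Relation.ReflTransGen.tail ih ?_
    obtain ⟨s, t, ⟨hs, ht, hst, hfree⟩, rfl⟩ := h
    refine ⟨s.map f, t.map f, ⟨⟨s, hs, rfl⟩, ⟨t, ht, rfl⟩, Finset.map_ssubset_map.2 hst, ?_⟩, ?_⟩
    · rintro _ ⟨u, hu, rfl⟩ hsu
      rw [hfree u hu (Finset.map_ssubset_map.1 hsu)]
    · rw [Set.image_sdiff (Finset.map_injective f), Set.image_pair]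

theorem chains_image {P Q : Type u} [Preorder P] [Preorder Q] (e : P ↪ Q)
    (he : ∀ a b, (e a ≤ e b ∨ e b ≤ e a) ↔ (a ≤ b ∨ b ≤ a)) (A : Set P) :
    chains (e '' A) = Finset.map e '' chains A := by
  classical
  have hchain : ∀ s : Finset P, IsChain (· ≤ ·) (s.map e : Set Q) ↔
      IsChain (· ≤ ·) (s : Set P) := by
    intro s
    rw [Finset.coe_map]
    constructor
    · intro h a ha b hb hab
      exact (he a b).1 (h ⟨a, ha, rfl⟩ ⟨b, hb, rfl⟩ (e.injective.ne hab))
    · rintro h _ ⟨a, ha, rfl⟩ _ ⟨b, hb, rfl⟩ hab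
      exact (he a b).2 (h ha hb (fun hab' => hab (congrArg e hab')))
  ext s
  constructor
  · rintro ⟨hs, hsc⟩
    obtain ⟨s, hsA, rfl⟩ := Finset.subset_set_image_iff.1 hs
    rw [← Finset.map_eq_image] at hsc ⊢
    exact ⟨s, ⟨hsA, (hchain s).1 hsc⟩, rfl⟩
  · rintro ⟨s, ⟨hs, hsc⟩, rfl⟩
    refine ⟨?_, (hchain s).2 hsc⟩
    rw [Finset.coe_map]
    exact Set.image_mono hs

/-- Successively removing all points outside `T`, in an order such that each point is removed when
only points of `T` are left below it. -/
theorem reflTransGen_of_hatDown {P : Type u} [PartialOrder P] [Finite P] {T : Set P}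
    (r : Set P → Set P → Prop)
    (h : ∀ A, ∀ x ∈ A, x ∉ T → hatDown A x = hatDown T x → r A (A \ {x})) :
    Relation.ReflTransGen r Set.univ T := by
  suffices ∀ A, T ⊆ A → Relation.ReflTransGen r A T from this _ (Set.subset_univ T)
  intro A hTA
  induction hn : A.ncard using Nat.strong_induction_on generalizing A with
  | _ n ih =>
    subst hn
    rcases Set.eq_empty_or_nonempty (A \ T) with hE | hE
    · rw [hTA.antisymm (Set.sdiff_eq_empty.1 hE)]
    · obtain ⟨x, ⟨hxA, hxT⟩, hmin⟩ := Set.Finite.exists_minimal (Set.toFinite _) hE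
      refine Relation.ReflTransGen.head (h A x hxA hxT ?_)
        (ih _ (Set.ncard_sdiff_singleton_lt_of_mem hxA) (A \ {x})
          (fun y hy => ⟨hTA hy, fun e => hxT (e ▸ hy)⟩) rfl)
      ext y
      refine ⟨fun hy => ⟨?_, hy.2⟩, fun hy => ⟨hTA hy.1, hy.2⟩⟩
      by_contra hyT
      exact hy.2.not_ge (hmin ⟨hy.1, hyT⟩ hy.2.le)

/-- Successively removing all points outside `T`, in an order such that each point is removed when
only points of `T` are left above it. -/
theorem reflTransGen_of_hatUp {P : Type u} [PartialOrder P] [Finite P] {T : Set P}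
    (r : Set P → Set P → Prop)
    (h : ∀ A, ∀ x ∈ A, x ∉ T → hatUp A x = hatUp T x → r A (A \ {x})) :
    Relation.ReflTransGen r Set.univ T :=
  reflTransGen_of_hatDown (P := Pᵒᵈ) (T := T) r h

namespace RelCyl

variable {X Z : Type u} [PartialOrder X] [PartialOrder Z] (R : Set (X × Z))

/-- The inclusion of `X` into the relation cylinder. -/
def inlEmb : X ↪o RelCyl X Z R where
  toFun := Sum.inl
  inj' := Sum.inl_injective
  map_rel_iff' := Iff.rfl

/-- The inclusion of `Z` into the relation cylinder. -/
def inrEmb : Z ↪o RelCyl X Z R where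
  toFun := Sum.inr
  inj' := Sum.inr_injective
  map_rel_iff' := Iff.rfl

theorem inlEmb_lt_inrEmb (hR : ∀ x x' z z', x ≤ x' → z' ≤ z → (x', z') ∈ R → (x, z) ∈ R) (x : X)
    (z : Z) : inlEmb R x < inrEmb R z ↔ (x, z) ∈ R := by
  have hle : inlEmb R x ≤ inrEmb R z ↔ (x, z) ∈ R :=
    ⟨fun ⟨x', z', hx, hz, h⟩ => hR x x' z z' hx hz h, fun h => ⟨x, z, le_rfl, le_rfl, h⟩⟩
  rw [lt_iff_le_and_ne, hle]
  exact and_iff_left Sum.inl_ne_inr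

theorem hatDown_inrEmb (hR : ∀ x x' z z', x ≤ x' → z' ≤ z → (x', z') ∈ R → (x, z) ∈ R) (z : Z) :
    hatDown (Set.range (inlEmb R)) (inrEmb R z) = inlEmb R '' {x | (x, z) ∈ R} := by
  ext y
  constructor
  · rintro ⟨⟨x, rfl⟩, hx⟩
    exact ⟨x, (inlEmb_lt_inrEmb R hR x z).1 hx, rfl⟩
  · rintro ⟨x, hx, rfl⟩
    exact ⟨⟨x, rfl⟩, (inlEmb_lt_inrEmb R hR x z).2 hx⟩

theorem hatUp_inlEmb (hR : ∀ x x' z z', x ≤ x' → z' ≤ z → (x', z') ∈ R → (x, z) ∈ R) (x : X) :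
    hatUp (Set.range (inrEmb R)) (inlEmb R x) = inrEmb R '' {z | (x, z) ∈ R} := by
  ext y
  constructor
  · rintro ⟨⟨z, rfl⟩, hz⟩
    exact ⟨z, (inlEmb_lt_inrEmb R hR x z).1 hz, rfl⟩
  · rintro ⟨z, hz, rfl⟩
    exact ⟨⟨z, rfl⟩, (inlEmb_lt_inrEmb R hR x z).2 hz⟩

/-- If points with lower part `{x : x R z}` can be removed for every `z`, then the relation cylinder
reduces to `X`. -/
theorem reflTransGen_range_inlEmb [Finite X] [Finite Z]
    (r : Set (RelCyl X Z R) → Set (RelCyl X Z R) → Prop)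
    (hR : ∀ x x' z z', x ≤ x' → z' ≤ z → (x', z') ∈ R → (x, z) ∈ R)
    (h : ∀ A z, inrEmb R z ∈ A → hatDown A (inrEmb R z) = inlEmb R '' {x | (x, z) ∈ R} →
      r A (A \ {inrEmb R z})) :
    Relation.ReflTransGen r Set.univ (Set.range (inlEmb R)) := by
  refine reflTransGen_of_hatDown r fun A y hyA hyT hy => ?_
  rcases y with x | z
  · exact absurd ⟨x, rfl⟩ hyT
  · exact h A z hyA (hy.trans (hatDown_inrEmb R hR z))

/-- If points with upper part `{z : x R z}` can be removed for every `x`, then the relation cylinder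
reduces to `Z`. -/
theorem reflTransGen_range_inrEmb [Finite X] [Finite Z]
    (r : Set (RelCyl X Z R) → Set (RelCyl X Z R) → Prop)
    (hR : ∀ x x' z z', x ≤ x' → z' ≤ z → (x', z') ∈ R → (x, z) ∈ R)
    (h : ∀ A x, inlEmb R x ∈ A → hatUp A (inlEmb R x) = inrEmb R '' {z | (x, z) ∈ R} →
      r A (A \ {inlEmb R x})) :
    Relation.ReflTransGen r Set.univ (Set.range (inrEmb R)) := by
  refine reflTransGen_of_hatUp r fun A y hyA hyT hy => ?_
  rcases y with x | z
  · exact h A x hyA (hy.trans (hatUp_inlEmb R hR x))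
  · exact absurd ⟨z, rfl⟩ hyT

end RelCyl

theorem SHE.of_univ_collapsesToSet_range {P Q : Type u} [PartialOrder P] [PartialOrder Q]
    [Finite P] [Finite Q] (e : Q ↪o P) (h : CollapsesToSet Set.univ (Set.range e)) :
    SHE (FinPoset.mk P) (FinPoset.mk Q) :=
  .rel _ _ ⟨_, h, ⟨e.orderIso⟩⟩

/-- A finite poset has the same simple homotopy type as its poset of nonempty chains. -/
theorem SHE.nonempty_chains (X : Type u) [PartialOrder X] [Finite X] :
    SHE (FinPoset.mk X) (FinPoset.mk ↑(chains (Set.univ : Set X) \ {∅})) := by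
  classical
  let R : Set (↑(chains (Set.univ : Set X) \ {∅}) × X) := {p | ∀ s ∈ (p.1 : Finset X), s ≤ p.2}
  have hR : ∀ x x' z z', x ≤ x' → z' ≤ z → (x', z') ∈ R → (x, z) ∈ R :=
    fun x x' z z' hx hz h s hs => (h s (hx hs)).trans hz
  refine .trans _ (FinPoset.mk (RelCyl _ _ R)) _ (.symm _ _ ?_) ?_
  · refine SHE.of_univ_collapsesToSet_range (RelCyl.inrEmb R)
      (RelCyl.reflTransGen_range_inrEmb R _ hR fun A σ hσ hA => ⟨_, hσ, Or.inr ?_, rfl⟩)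
    rw [hA]
    refine ContractibleSet.congr ((RelCyl.inrEmb R).imageIso _) ?_
    obtain ⟨m, hm⟩ := (σ : Finset X).exists_maximal (Finset.nonempty_iff_ne_empty.2 σ.2.2)
    refine .of_isLeast (m := m) ⟨fun s hs => ?_, fun y hy => hy m hm.1⟩
    exact (σ.2.1.2.total hs hm.1).elim id fun hms => hm.2 hs hms
  · refine SHE.of_univ_collapsesToSet_range (RelCyl.inlEmb R)
      (RelCyl.reflTransGen_range_inlEmb R _ hR fun A y hy hA => ⟨_, hy, Or.inl ?_, rfl⟩)
    rw [hA]
    refine ContractibleSet.congr ((RelCyl.inlEmb R).imageIso _) ?_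
    refine .of_joins (c := ⟨{y}, ⟨⟨Set.subset_univ _, by simp⟩, Finset.singleton_ne_empty y⟩⟩)
      (fun s hs => (Finset.mem_singleton.1 hs).le) fun σ hσ => ?_
    refine ⟨⟨insert y (σ : Finset X), ⟨⟨Set.subset_univ _, ?_⟩, Finset.insert_ne_empty _ _⟩⟩,
      ⟨?_, ?_, ?_⟩, ?_⟩
    · rw [Finset.coe_insert]
      exact σ.2.1.2.insert fun b hb _ => Or.inr (hσ b hb)
    · intro s hs
      rcases Finset.mem_insert.1 hs with rfl | hs
      · exact le_rfl
      · exact hσ s hs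
    · exact Finset.subset_insert _ _
    · exact Finset.singleton_subset_iff.2 (Finset.mem_insert_self _ _)
    · rintro z ⟨-, h1, h2⟩
      exact Finset.insert_subset (Finset.singleton_subset_iff.1 h2) h1

/-- If the chains of `Q` reduce to those of the image of a comparability-preserving embedding of
`P`, then `P` has the same simple homotopy type as the poset of nonempty chains of `Q`. -/
theorem SHE.of_chains_collapsesTo_range {P Q : Type u} [PartialOrder P] [PartialOrder Q]
    [Finite P] [Finite Q] (e : P ↪ Q) (he : ∀ a b, (e a ≤ e b ∨ e b ≤ e a) ↔ (a ≤ b ∨ b ≤ a))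
    (h : CxCollapsesTo (chains (Set.univ : Set Q)) (chains (Set.range e))) :
    SHE (FinPoset.mk P) (FinPoset.mk ↑(chains (Set.univ : Set Q) \ {∅})) := by
  refine .trans _ _ _ (SHE.nonempty_chains P) (.trans _ _ _ ?_ (.symm _ _
    (SHE.of_collapsesToSet (h.collapsesToSet (fun s t hts hs => ?_) ?_))))
  · have himage : Finset.mapEmbedding e '' (chains (Set.univ : Set P) \ {∅}) =
        chains (Set.range e) \ {∅} := by
      rw [← Set.image_univ, chains_image e he, Set.image_sdiff (Finset.mapEmbedding e).injective,
        Set.image_singleton]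
      rfl
    exact SHE.of_orderIso (((Finset.mapEmbedding e).imageIso _).trans (OrderIso.setCongr _ _ himage))
  · exact ⟨Set.subset_univ _, hs.2.mono hts⟩
  · exact ⟨by simp, by simp⟩

/-- Nerve theorem without the good-cover condition, collapsible
version: if for every `x` the subspace `I_x ⊆ N₀(U)` of intersections containing `x` is
collapsible, then `X` and `N₀(U)` have the same simple homotopy type. -/
theorem stmt_12 {X I : Type u} [PartialOrder X] [Finite X] [Finite I]
    (U : I → Set X) (hopen : ∀ i, IsLowerSet (U i)) (hcover : (⋃ i, U i) = Set.univ)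
    (hIx : ∀ x : X,
      CollapsibleSet {J : NerveColl U | x ∈ ⋂ i ∈ (J : Finset I), U i}) :
    SHE (FinPoset.mk X) (FinPoset.mk (NerveColl U)) := by
  let R : Set (X × (NerveColl U)ᵒᵈ) :=
    {p | p.1 ∈ ⋂ i ∈ ((OrderDual.ofDual p.2 : NerveColl U) : Finset I), U i}
  have hR : ∀ x x' z z', x ≤ x' → z' ≤ z → (x', z') ∈ R → (x, z) ∈ R := by
    intro x x' z z' hx hz h
    exact Set.mem_iInter₂.2 fun i hi => hopen i hx (Set.mem_iInter₂.1 h i (hz hi))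
  let e₁ : X ↪ RelCyl X (NerveColl U)ᵒᵈ R := (RelCyl.inlEmb R).toEmbedding
  let e₂ : NerveColl U ↪ RelCyl X (NerveColl U)ᵒᵈ R :=
    OrderDual.toDual.toEmbedding.trans (RelCyl.inrEmb R).toEmbedding
  have he₁ : ∀ a b, (e₁ a ≤ e₁ b ∨ e₁ b ≤ e₁ a) ↔ (a ≤ b ∨ b ≤ a) := fun a b => Iff.rfl
  have he₂ : ∀ a b, (e₂ a ≤ e₂ b ∨ e₂ b ≤ e₂ a) ↔ (a ≤ b ∨ b ≤ a) := fun a b => or_comm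
  refine .trans _ _ _ (SHE.of_chains_collapsesTo_range e₁ he₁ ?_)
    (.symm _ _ (SHE.of_chains_collapsesTo_range e₂ he₂ ?_))
  · have h := RelCyl.reflTransGen_range_inlEmb R
      (fun A B => CxCollapsesTo (chains A) (chains B)) hR fun A J _ hA => by
        refine chains_deleteVertex_of_hatDown ?_
        rw [hA]
        have := ((OrderDual.ofDual J).2.2.chains_collapsesTo).map e₁
        rwa [← chains_image e₁ he₁, Set.image_empty] at this
    exact Relation.ReflTransGen.lift' chains (fun _ _ => id) _ _ h
  · have h := RelCyl.reflTransGen_range_inrEmb R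
      (fun A B => CxCollapsesTo (chains A) (chains B)) hR fun A x _ hA => by
        refine chains_deleteVertex_of_hatUp ?_
        rw [hA]
        have := ((hIx x).chains_collapsesTo).map e₂
        rwa [← chains_image e₂ he₂, Set.image_empty] at this
    exact Relation.ReflTransGen.lift' chains (fun _ _ => id) _ _ h
end
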